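/- arXiv:2406.17395 — 3 statements merged into one kernel-verified Lean document; each statement's English description precedes it below -/
import Mathlib

section
/- No finite simple connected graph whose adjacency matrix has exactly three distinct real eigenvalues has coherent rank equal to 7. -/
open Matrix

/-- `θ` is an eigenvalue of the (real) adjacency matrix of `G`. -/
def adjEig {V : Type} [Fintype V] [DecidableEq V] (G : SimpleGraph V) [DecidableRel G.Adj]
    (θ : ℝ) : Prop :=
  ∃ f : V → ℝ, f ≠ 0 ∧ (SimpleGraph.adjMatrix ℝ G).mulVec f = θ • f

/-- A coherent configuration of rank `r` on the finite set `V`, given as a family of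
`{0,1}`-matrices `A 1, …, A r`. -/
def IsCoherentConfig {V : Type} [Fintype V] [DecidableEq V] {r : ℕ}
    (A : Fin r → Matrix V V ℝ) : Prop :=
  (∀ i x y, A i x y = 0 ∨ A i x y = 1) ∧
  (∑ i, A i) = Matrix.of (fun _ _ => (1 : ℝ)) ∧
  (∀ i, ∃ j, (A i)ᵀ = A j) ∧
  (∃ Δ : Finset (Fin r), ∑ i ∈ Δ, A i = 1) ∧
  (∀ i j, A i * A j ∈ Submodule.span ℝ (Set.range A))

/-- The coherent rank of `G` is `n`: `n` is the least rank of a coherent configuration on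
the vertex set of `G` whose real linear span contains the adjacency matrix of `G`. -/
def HasCoherentRank {V : Type} [Fintype V] [DecidableEq V] (G : SimpleGraph V)
    [DecidableRel G.Adj] (n : ℕ) : Prop :=
  IsLeast {r : ℕ | ∃ A : Fin r → Matrix V V ℝ,
    IsCoherentConfig A ∧ SimpleGraph.adjMatrix ℝ G ∈ Submodule.span ℝ (Set.range A)} n


/-- Matrices whose entries are constant on the colour classes of `κ`. -/
def colorSubmodule {V ι : Type} (κ : V → V → ι) : Submodule ℝ (Matrix V V ℝ) where
  carrier := {X | ∀ x y x' y', κ x y = κ x' y' → X x y = X x' y'}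
  zero_mem' := by intro x y x' y' _; rfl
  add_mem' := by
    intro X Y hX hY x y x' y' h
    simp only [Matrix.add_apply]
    rw [hX x y x' y' h, hY x y x' y' h]
  smul_mem' := by
    intro r X hX x y x' y' h
    simp only [Matrix.smul_apply]
    rw [hX x y x' y' h]

theorem exists_coherentConfig_of_coloring {V ι : Type} [Fintype V] [DecidableEq V]
    [DecidableEq ι] (κ : V → V → ι)
    (hT : ∀ x y x' y', κ x y = κ x' y' → κ y x = κ y' x')
    (hI : ∀ x y y', κ x x = κ y y' → y = y')
    (hmul : ∀ X ∈ colorSubmodule κ, ∀ Y ∈ colorSubmodule κ, X * Y ∈ colorSubmodule κ) :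
    ∃ A : Fin (Finset.univ.image fun p : V × V => κ p.1 p.2).card → Matrix V V ℝ,
      IsCoherentConfig A ∧ ∀ X ∈ colorSubmodule κ, X ∈ Submodule.span ℝ (Set.range A) := by
  classical
  set S := Finset.univ.image fun p : V × V => κ p.1 p.2 with hS
  let e : S ≃ Fin S.card := S.equivFin
  have hmem : ∀ x y, κ x y ∈ S := fun x y =>
    Finset.mem_image.2 ⟨(x, y), Finset.mem_univ _, rfl⟩
  let c : V → V → Fin S.card := fun x y => e ⟨κ x y, hmem x y⟩
  have hc : ∀ x y x' y', c x y = c x' y' ↔ κ x y = κ x' y' := by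
    intro x y x' y'
    simp [c]
  have hsurj : ∀ i, ∃ x y, c x y = i := by
    intro i
    obtain ⟨p, -, hp⟩ := Finset.mem_image.1 (e.symm i).2
    refine ⟨p.1, p.2, ?_⟩
    simp only [c]
    rw [← e.apply_symm_apply i]
    congr 1
    exact Subtype.ext hp
  let A : Fin S.card → Matrix V V ℝ := fun i => Matrix.of fun x y => if c x y = i then 1 else 0
  have hspan : ∀ X ∈ colorSubmodule κ, X ∈ Submodule.span ℝ (Set.range A) := by
    intro X hX
    choose u v huv using hsurj
    have : X = ∑ i, X (u i) (v i) • A i := by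
      ext x y
      rw [Matrix.sum_apply]
      simp only [Matrix.smul_apply, A, Matrix.of_apply, smul_eq_mul, mul_ite, mul_one, mul_zero]
      rw [Finset.sum_ite_eq]
      simp only [Finset.mem_univ, if_true]
      exact hX _ _ _ _ ((hc _ _ _ _).1 (huv (c x y)).symm)
    rw [this]
    exact Submodule.sum_mem _ fun i _ => Submodule.smul_mem _ _
      (Submodule.subset_span ⟨i, rfl⟩)
  have hA : ∀ i, A i ∈ colorSubmodule κ := by
    intro i x y x' y' h
    simp only [A, Matrix.of_apply, (hc x y x' y').2 h]
  refine ⟨A, ⟨?_, ?_, ?_, ?_, ?_⟩, hspan⟩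
  · intro i x y
    simp only [A, Matrix.of_apply]
    split_ifs <;> simp
  · ext x y
    rw [Matrix.sum_apply]
    simp [A]
  · intro i
    obtain ⟨x, y, rfl⟩ := hsurj i
    refine ⟨c y x, ?_⟩
    ext u v
    simp only [A, Matrix.of_apply, Matrix.transpose_apply, hc]
    congr 1
    exact propext ⟨hT _ _ _ _, hT _ _ _ _⟩
  · refine ⟨Finset.univ.filter fun i => ∃ x, c x x = i, ?_⟩
    ext x y
    rw [Matrix.sum_apply]
    simp only [A, Matrix.of_apply, Finset.sum_ite_eq, Finset.mem_filter, Finset.mem_univ,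
      true_and, Matrix.one_apply]
    congr 1
    refine propext ⟨?_, ?_⟩
    · rintro ⟨z, hz⟩
      exact hI z x y ((hc _ _ _ _).1 hz)
    · rintro rfl
      exact ⟨x, rfl⟩
  · exact fun i j => hspan _ (hmul _ (hA i) _ (hA j))

theorem HasCoherentRank.le_card_image {V ι : Type} [Fintype V] [DecidableEq V]
    [DecidableEq ι] {G : SimpleGraph V} [DecidableRel G.Adj] {n : ℕ} (hG : HasCoherentRank G n)
    (κ : V → V → ι)
    (hT : ∀ x y x' y', κ x y = κ x' y' → κ y x = κ y' x')
    (hI : ∀ x y y', κ x x = κ y y' → y = y')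
    (hmul : ∀ X ∈ colorSubmodule κ, ∀ Y ∈ colorSubmodule κ, X * Y ∈ colorSubmodule κ)
    (hadj : G.adjMatrix ℝ ∈ colorSubmodule κ) :
    n ≤ (Finset.univ.image fun p : V × V => κ p.1 p.2).card := by
  obtain ⟨A, hA, hspan⟩ := exists_coherentConfig_of_coloring κ hT hI hmul
  exact hG.2 ⟨A, hA, hspan _ hadj⟩

/-- A coherent configuration colours pairs so that its span consists of matrices constant on
colours and contains the indicator matrix of each fibre. -/
theorem IsCoherentConfig.exists_coloring {V : Type} [Fintype V] [DecidableEq V] {r : ℕ}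
    {A : Fin r → Matrix V V ℝ} (hA : IsCoherentConfig A) :
    ∃ c : V → V → Fin r,
      (∀ X ∈ Submodule.span ℝ (Set.range A), X ∈ colorSubmodule c) ∧
      ∀ u : V, Matrix.diagonal (fun z => if c z z = c u u then (1 : ℝ) else 0) ∈
        Submodule.span ℝ (Set.range A) := by
  obtain ⟨h01, hJ, -, ⟨Δ, hΔ⟩, -⟩ := hA
  have hsum : ∀ x y, ∑ i, A i x y = 1 := by
    intro x y
    have := congrFun (congrFun hJ x) y
    rwa [Matrix.sum_apply] at this
  have hex : ∀ x y, ∃ i, A i x y = 1 := by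
    intro x y
    by_contra! h
    have h0 : ∀ i, A i x y = 0 := fun i => (h01 i x y).resolve_right (h i)
    simpa [h0] using hsum x y
  have huniq : ∀ x y i j, A i x y = 1 → A j x y = 1 → i = j := by
    intro x y i j hi hj
    by_contra hij
    have h1 : ∑ l ∈ {i, j}, A l x y ≤ ∑ l, A l x y :=
      Finset.sum_le_sum_of_subset_of_nonneg (Finset.subset_univ _) (by
        intro l _ _
        rcases h01 l x y with h | h <;> simp [h])
    rw [Finset.sum_pair hij, hi, hj, hsum] at h1
    norm_num at h1
  choose c hc using hex
  have hval : ∀ i x y, A i x y = if c x y = i then 1 else 0 := by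
    intro i x y
    split_ifs with h
    · rw [← h]; exact hc x y
    · exact (h01 i x y).resolve_right fun h1 => h (huniq _ _ _ _ (hc x y) h1)
  refine ⟨c, ?_, ?_⟩
  · intro X hX
    refine (Submodule.span_le.2 ?_) hX
    rintro _ ⟨i, rfl⟩ x y x' y' h
    simp only [hval, h]
  · intro u
    have hmem : c u u ∈ Δ := by
      have h1 := congrFun (congrFun hΔ u) u
      rw [Matrix.sum_apply, Matrix.one_apply_eq] at h1
      by_contra hu
      have : ∑ i ∈ Δ, A i u u = 0 := by
        refine Finset.sum_eq_zero fun i hi => ?_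
        rw [hval, if_neg]
        rintro rfl
        exact hu hi
      rw [this] at h1
      norm_num at h1
    have : Matrix.diagonal (fun z => if c z z = c u u then (1 : ℝ) else 0) = A (c u u) := by
      ext x y
      rw [Matrix.diagonal_apply, hval]
      by_cases hxy : x = y
      · subst hxy; simp
      · rw [if_neg hxy, if_neg]
        intro h
        have h1 := congrFun (congrFun hΔ x) y
        rw [Matrix.sum_apply, Matrix.one_apply_ne hxy] at h1
        have h2 := (Finset.sum_eq_zero_iff_of_nonneg (fun i _ => by
          rcases h01 i x y with h | h <;> simp [h])).1 h1 _ hmem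
        rw [hval, if_pos h] at h2
        norm_num at h2
    rw [this]
    exact Submodule.subset_span ⟨_, rfl⟩

theorem IsCoherentConfig.mul_mem {V : Type} [Fintype V] [DecidableEq V] {r : ℕ}
    {A : Fin r → Matrix V V ℝ} (hA : IsCoherentConfig A) {X Y : Matrix V V ℝ}
    (hX : X ∈ Submodule.span ℝ (Set.range A)) (hY : Y ∈ Submodule.span ℝ (Set.range A)) :
    X * Y ∈ Submodule.span ℝ (Set.range A) := by
  induction hX using Submodule.span_induction with
  | mem X hX =>
    obtain ⟨i, rfl⟩ := hX
    induction hY using Submodule.span_induction with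
    | mem Y hY => obtain ⟨j, rfl⟩ := hY; exact hA.2.2.2.2 i j
    | zero => simp
    | add Y Z _ _ hY hZ => rw [Matrix.mul_add]; exact Submodule.add_mem _ hY hZ
    | smul a Y _ hY => rw [Matrix.mul_smul]; exact Submodule.smul_mem _ _ hY
  | zero => simp
  | add X Z _ _ hX hZ => rw [Matrix.add_mul]; exact Submodule.add_mem _ hX hZ
  | smul a X _ hX => rw [Matrix.smul_mul]; exact Submodule.smul_mem _ _ hX

theorem IsCoherentConfig.one_mem {V : Type} [Fintype V] [DecidableEq V] {r : ℕ}
    {A : Fin r → Matrix V V ℝ} (hA : IsCoherentConfig A) :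
    (1 : Matrix V V ℝ) ∈ Submodule.span ℝ (Set.range A) := by
  obtain ⟨Δ, hΔ⟩ := hA.2.2.2.1
  rw [← hΔ]
  exact Submodule.sum_mem _ fun i _ => Submodule.subset_span ⟨i, rfl⟩

theorem IsCoherentConfig.of_one_mem {V : Type} [Fintype V] [DecidableEq V] {r : ℕ}
    {A : Fin r → Matrix V V ℝ} (hA : IsCoherentConfig A) :
    Matrix.of (fun _ _ => (1 : ℝ)) ∈ Submodule.span ℝ (Set.range A) := by
  rw [← hA.2.1]
  exact Submodule.sum_mem _ fun i _ => Submodule.subset_span ⟨i, rfl⟩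

theorem HasCoherentRank.exists_coloring {V : Type} [Fintype V] [DecidableEq V]
    {G : SimpleGraph V} [DecidableRel G.Adj] {n : ℕ} (hG : HasCoherentRank G n) :
    ∃ c : V → V → Fin n,
      (∀ x y x' y', c x y = c x' y' → c x x = c x' x' ∧ c y y = c y' y' ∧
        (x = y ↔ x' = y') ∧ (G.Adj x y ↔ G.Adj x' y')) ∧
      ∀ u x x', c x x = c x' x' →
        ∑ z, (if c z z = c u u then G.adjMatrix ℝ x z else 0) =
          ∑ z, (if c z z = c u u then G.adjMatrix ℝ x' z else 0) := by
  obtain ⟨⟨A, hA, hadj⟩, -⟩ := hG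
  obtain ⟨c, hc, hE⟩ := hA.exists_coloring
  refine ⟨c, ?_, ?_⟩
  · intro x y x' y' h
    refine ⟨?_, ?_, ?_, ?_⟩
    · have := hc _ (hA.mul_mem (hE x) hA.of_one_mem) _ _ _ _ h
      simp only [Matrix.diagonal_mul, Matrix.of_apply, mul_one, if_true] at this
      by_contra hne
      rw [if_neg (Ne.symm hne)] at this
      norm_num at this
    · have := hc _ (hA.mul_mem hA.of_one_mem (hE y)) _ _ _ _ h
      simp only [Matrix.mul_diagonal, Matrix.of_apply, one_mul, if_true] at this
      by_contra hne
      rw [if_neg (Ne.symm hne)] at this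
      norm_num at this
    · have := hc _ hA.one_mem _ _ _ _ h
      simp only [Matrix.one_apply] at this
      by_cases h1 : x = y <;> by_cases h2 : x' = y' <;> simp_all
    · have := hc _ hadj _ _ _ _ h
      simp only [SimpleGraph.adjMatrix_apply] at this
      by_cases h1 : G.Adj x y <;> by_cases h2 : G.Adj x' y' <;> simp_all
  · intro u x x' h
    have := hc _ (hA.mul_mem hadj (hA.mul_mem (hE u) hA.of_one_mem)) _ _ _ _ h
    simpa [Matrix.mul_apply, Matrix.diagonal_mul, -SimpleGraph.adjMatrix_mul_apply,
      -SimpleGraph.adjMatrix_apply, Matrix.diagonal_apply] using this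

/-- Eigenvectors for the eigenvalue of a positive eigenvector are multiples of it. -/
theorem SimpleGraph.Connected.exists_eq_smul_of_eigenvector {V : Type} [Fintype V]
    [DecidableEq V] {G : SimpleGraph V} [DecidableRel G.Adj] (hconn : G.Connected)
    {α v : V → ℝ} {l : ℝ} (hpos : ∀ x, 0 < α x)
    (hα : (G.adjMatrix ℝ).mulVec α = l • α) (hv : (G.adjMatrix ℝ).mulVec v = l • v) :
    ∃ r : ℝ, ∀ x, v x = r * α x := by
  have := hconn.nonempty
  obtain ⟨x₀, hx₀⟩ := Finite.exists_min fun x => v x / α x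
  refine ⟨v x₀ / α x₀, ?_⟩
  set r := v x₀ / α x₀
  have hw0 : ∀ x, 0 ≤ v x - r * α x := by
    intro x
    have := (le_div_iff₀ (hpos x)).1 (hx₀ x)
    linarith
  have hw : ∀ x, ∑ z, G.adjMatrix ℝ x z * (v z - r * α z) = l * (v x - r * α x) := by
    intro x
    have h1 := congrFun hα x
    have h2 := congrFun hv x
    simp only [Matrix.mulVec, dotProduct, Pi.smul_apply, smul_eq_mul] at h1 h2
    simp only [mul_sub, Finset.sum_sub_distrib, h2]
    rw [← mul_assoc, mul_comm l r, mul_assoc, ← h1, Finset.mul_sum]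
    congr 1
    exact Finset.sum_congr rfl fun z _ => by ring
  have hstep : ∀ x y, G.Adj x y → v x - r * α x = 0 → v y - r * α y = 0 := by
    intro x y hxy hx
    have h1 := hw x
    rw [hx, mul_zero] at h1
    have h2 := (Finset.sum_eq_zero_iff_of_nonneg (fun z _ => mul_nonneg (by
      rw [SimpleGraph.adjMatrix_apply]; split_ifs <;> norm_num) (hw0 z))).1 h1 y
      (Finset.mem_univ _)
    simpa [SimpleGraph.adjMatrix_apply, hxy] using h2
  have hx0 : v x₀ - r * α x₀ = 0 := by
    have := (hpos x₀).ne'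
    simp only [r]
    field_simp
    ring
  intro x
  obtain ⟨p⟩ := hconn.preconnected x₀ x
  have : ∀ {a b : V}, G.Walk a b → v a - r * α a = 0 → v b - r * α b = 0 := by
    intro a b p
    induction p with
    | nil => exact id
    | cons h _ ih => exact fun ha => ih (hstep _ _ h ha)
  linarith [this p hx0]

theorem adjMatrix_cubic_eq_zero {V : Type} [Fintype V] [DecidableEq V] (G : SimpleGraph V)
    [DecidableRel G.Adj] {t0 t1 t2 : ℝ} (h : ∀ θ, adjEig G θ → θ = t0 ∨ θ = t1 ∨ θ = t2) :
    (G.adjMatrix ℝ - t0 • 1) * ((G.adjMatrix ℝ - t1 • 1) * (G.adjMatrix ℝ - t2 • 1)) = 0 := by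
  have hA : (G.adjMatrix ℝ).IsHermitian := by
    rw [Matrix.IsHermitian, Matrix.conjTranspose_eq_transpose_of_trivial]
    exact G.transpose_adjMatrix
  have key : ∀ i, ((G.adjMatrix ℝ - t0 • 1) * ((G.adjMatrix ℝ - t1 • 1) *
      (G.adjMatrix ℝ - t2 • 1))).mulVec (hA.eigenvectorBasis i).ofLp = 0 := by
    intro i
    have h1 := hA.mulVec_eigenvectorBasis i
    set w := (hA.eigenvectorBasis i).ofLp with hw
    set m := hA.eigenvalues i
    have hw0 : w ≠ 0 := by
      intro h0
      refine hA.eigenvectorBasis.toBasis.ne_zero i ?_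
      simpa [hw] using h0
    have hs : ∀ t : ℝ, (G.adjMatrix ℝ - t • 1).mulVec w = (m - t) • w := by
      intro t
      rw [Matrix.sub_mulVec, h1, Matrix.smul_mulVec, Matrix.one_mulVec, sub_smul]
    rw [← Matrix.mulVec_mulVec, ← Matrix.mulVec_mulVec, hs, Matrix.mulVec_smul, hs,
      Matrix.mulVec_smul, Matrix.mulVec_smul, hs, smul_smul, smul_smul]
    have : (m - t2) * (m - t1) * (m - t0) = 0 := by
      rcases h m ⟨w, hw0, h1⟩ with h | h | h <;> simp [h]
    rw [this, zero_smul]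
  apply Matrix.toLin'.injective
  rw [map_zero]
  refine (hA.eigenvectorBasis.toBasis.map (WithLp.linearEquiv 2 ℝ (V → ℝ))).ext fun i => ?_
  exact key i

theorem SimpleGraph.Connected.exists_adjMatrix_sq_of_cubic {V : Type} [Fintype V] [DecidableEq V]
    {G : SimpleGraph V} [DecidableRel G.Adj] (hconn : G.Connected) {t0 t1 t2 : ℝ}
    (h01 : t0 ≠ t1) (h02 : t0 ≠ t2) (h : ∀ θ, adjEig G θ → θ = t0 ∨ θ = t1 ∨ θ = t2)
    {α : V → ℝ} (hpos : ∀ x, 0 < α x) (hα : (G.adjMatrix ℝ).mulVec α = t0 • α) :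
    ∃ s p c : ℝ, c ≠ 0 ∧ ∀ x y, (G.adjMatrix ℝ * G.adjMatrix ℝ) x y =
      s * G.adjMatrix ℝ x y - p * (if x = y then 1 else 0) + c * α x * α y := by
  have hcub := adjMatrix_cubic_eq_zero G h
  set A := G.adjMatrix ℝ
  set M := (A - t1 • 1) * (A - t2 • 1) with hM
  have hMent : ∀ x y, (A * A) x y =
      (t1 + t2) * A x y - t1 * t2 * (if x = y then 1 else 0) + M x y := by
    have : M = A * A - (t1 + t2) • A + (t1 * t2) • 1 := by
      rw [hM]
      simp only [sub_mul, mul_sub, Matrix.mul_smul, Matrix.smul_mul, mul_one, one_mul, smul_smul]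
      module
    intro x y
    rw [this]
    simp only [Matrix.add_apply, Matrix.sub_apply, Matrix.smul_apply, Matrix.one_apply,
      smul_eq_mul]
    ring
  have hAsymm : ∀ x y, A x y = A y x := fun x y => by
    simp [A, SimpleGraph.adjMatrix_apply, G.adj_comm]
  have hMsymm : ∀ x y, M x y = M y x := by
    intro x y
    have h1 := hMent x y
    have h2 := hMent y x
    have h3 : (A * A) x y = (A * A) y x := by
      simp only [Matrix.mul_apply]
      exact Finset.sum_congr rfl fun z _ => by rw [hAsymm x z, hAsymm z y, mul_comm]
    have h4 : (if x = y then (1 : ℝ) else 0) = if y = x then 1 else 0 := by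
      simp [eq_comm]
    rw [h3, hAsymm x y, h4] at h1
    linarith
  have hcol : ∀ y, ∃ r : ℝ, ∀ x, M x y = r * α x := by
    intro y
    refine hconn.exists_eq_smul_of_eigenvector (v := fun x => M x y) hpos hα ?_
    have h1 : A * M = t0 • M := by
      rw [sub_mul, sub_eq_zero, Matrix.smul_mul, one_mul] at hcub
      exact hcub
    ext x
    exact congrFun (congrFun h1 x) y
  choose r hr using hcol
  obtain ⟨x₀⟩ := hconn.nonempty
  have hMc : ∀ x y, M x y = r x₀ / α x₀ * α x * α y := by
    intro x y
    have h0 := (hpos x₀).ne'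
    have h1 : r x * α x₀ = r x₀ * α x := by rw [← hr, ← hr, hMsymm]
    rw [hMsymm, hr x y]
    field_simp
    linear_combination α y * h1
  refine ⟨t1 + t2, t1 * t2, r x₀ / α x₀, ?_, fun x y => by rw [hMent, hMc]⟩
  intro hc0
  have hM0 : M = 0 := by
    ext x y
    rw [hMc, hc0]
    simp
  have hs : ∀ t : ℝ, (A - t • 1).mulVec α = (t0 - t) • α := by
    intro t
    rw [Matrix.sub_mulVec, hα, Matrix.smul_mulVec, Matrix.one_mulVec, sub_smul]
  have h1 : M.mulVec α = ((t0 - t2) * (t0 - t1)) • α := by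
    rw [hM, ← Matrix.mulVec_mulVec, hs, Matrix.mulVec_smul, hs, smul_smul]
  have h2 := congrFun h1 x₀
  rw [hM0, Matrix.zero_mulVec] at h2
  simp only [Pi.zero_apply, Pi.smul_apply, smul_eq_mul] at h2
  exact mul_ne_zero (mul_ne_zero (sub_ne_zero.2 h02) (sub_ne_zero.2 h01)) (hpos x₀).ne' h2.symm

theorem SimpleGraph.Connected.exists_adjMatrix_sq {V : Type} [Fintype V] [DecidableEq V]
    {G : SimpleGraph V} [DecidableRel G.Adj] (hconn : G.Connected)
    (h3 : ∃ t0 t1 t2 : ℝ, t0 ≠ t1 ∧ t0 ≠ t2 ∧ t1 ≠ t2 ∧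
      {θ : ℝ | adjEig G θ} = {t0, t1, t2})
    {α : V → ℝ} {l : ℝ} (hpos : ∀ x, 0 < α x) (hα : (G.adjMatrix ℝ).mulVec α = l • α) :
    ∃ s p c : ℝ, c ≠ 0 ∧ ∀ x y, (G.adjMatrix ℝ * G.adjMatrix ℝ) x y =
      s * G.adjMatrix ℝ x y - p * (if x = y then 1 else 0) + c * α x * α y := by
  obtain ⟨t0, t1, t2, h01, h02, h12, hset⟩ := h3
  have h : ∀ θ, adjEig G θ → θ = t0 ∨ θ = t1 ∨ θ = t2 := by
    intro θ hθ
    have : θ ∈ {θ : ℝ | adjEig G θ} := hθ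
    rw [hset] at this
    simpa using this
  have hl : adjEig G l := by
    refine ⟨α, ?_, hα⟩
    obtain ⟨x⟩ := hconn.nonempty
    exact fun h0 => (hpos x).ne' (congrFun h0 x)
  rcases h l hl with rfl | rfl | rfl
  · exact hconn.exists_adjMatrix_sq_of_cubic h01 h02 h hpos hα
  · exact hconn.exists_adjMatrix_sq_of_cubic h01.symm h12
      (fun θ hθ => by have := h θ hθ; tauto) hpos hα
  · exact hconn.exists_adjMatrix_sq_of_cubic h02.symm h12.symm
      (fun θ hθ => by have := h θ hθ; tauto) hpos hα

/-- The colour of a pair of vertices: the classes of its ends under `t`, and whether the ends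
are equal or adjacent. -/
def pairColor {V : Type} [DecidableEq V] (G : SimpleGraph V) [DecidableRel G.Adj] (t : V → Bool)
    (x y : V) : Bool × Bool × Bool × Bool :=
  (t x, t y, decide (x = y), decide (G.Adj x y))

theorem pairColor_eq_iff {V : Type} [DecidableEq V] {G : SimpleGraph V} [DecidableRel G.Adj]
    {t : V → Bool} {x y x' y' : V} :
    pairColor G t x y = pairColor G t x' y' ↔
      t x = t x' ∧ t y = t y' ∧ (x = y ↔ x' = y') ∧ (G.Adj x y ↔ G.Adj x' y') := by
  simp [pairColor]

theorem pairColor_of_class_mem {V : Type} [DecidableEq V] {G : SimpleGraph V}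
    [DecidableRel G.Adj] {t : V → Bool} (g : Bool → Bool → ℝ) :
    Matrix.of (fun x y => g (t x) (t y)) ∈ colorSubmodule (pairColor G t) := by
  intro x y x' y' h
  rw [pairColor_eq_iff] at h
  simp only [Matrix.of_apply, h.1, h.2.1]

theorem pairColor_diagonal_mul_mem {V : Type} [Fintype V] [DecidableEq V] {G : SimpleGraph V}
    [DecidableRel G.Adj] {t : V → Bool} (p : Bool → ℝ) {X : Matrix V V ℝ}
    (hX : X ∈ colorSubmodule (pairColor G t)) :
    Matrix.diagonal (fun x => p (t x)) * X ∈ colorSubmodule (pairColor G t) := by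
  intro x y x' y' h
  rw [Matrix.diagonal_mul, Matrix.diagonal_mul, hX _ _ _ _ h, (pairColor_eq_iff.1 h).1]

theorem pairColor_mul_diagonal_mem {V : Type} [Fintype V] [DecidableEq V] {G : SimpleGraph V}
    [DecidableRel G.Adj] {t : V → Bool} (p : Bool → ℝ) {X : Matrix V V ℝ}
    (hX : X ∈ colorSubmodule (pairColor G t)) :
    X * Matrix.diagonal (fun x => p (t x)) ∈ colorSubmodule (pairColor G t) := by
  intro x y x' y' h
  rw [Matrix.mul_diagonal, Matrix.mul_diagonal, hX _ _ _ _ h, (pairColor_eq_iff.1 h).2.1]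

theorem pairColor_adjMatrix_mem {V : Type} [DecidableEq V] {G : SimpleGraph V}
    [DecidableRel G.Adj] {t : V → Bool} :
    G.adjMatrix ℝ ∈ colorSubmodule (pairColor G t) := by
  intro x y x' y' h
  simp only [SimpleGraph.adjMatrix_apply, (pairColor_eq_iff.1 h).2.2.2]

/-- The part of the adjacency matrix lying inside the classes of `t`. -/
def classAdj {V : Type} (G : SimpleGraph V) [DecidableRel G.Adj] (t : V → Bool) :
    Matrix V V ℝ :=
  Matrix.of fun x y => if t y = t x then G.adjMatrix ℝ x y else 0

theorem pairColor_classAdj_mem {V : Type} [DecidableEq V] {G : SimpleGraph V}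
    [DecidableRel G.Adj] {t : V → Bool} :
    classAdj G t ∈ colorSubmodule (pairColor G t) := by
  intro x y x' y' h
  rw [pairColor_eq_iff] at h
  simp only [classAdj, Matrix.of_apply, SimpleGraph.adjMatrix_apply, h]

theorem classAdj_comm {V : Type} {G : SimpleGraph V} [DecidableRel G.Adj] {t : V → Bool}
    (x y : V) : classAdj G t x y = classAdj G t y x := by
  simp only [classAdj, Matrix.of_apply, SimpleGraph.adjMatrix_apply, G.adj_comm x y,
    eq_comm (a := t x)]

theorem classAdj_mul_apply {V : Type} {G : SimpleGraph V} [DecidableRel G.Adj] {t : V → Bool}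
    (x y : V) (f : Bool → ℝ) : classAdj G t x y * f (t y) = classAdj G t x y * f (t x) := by
  simp only [classAdj, Matrix.of_apply]
  split_ifs with h
  · rw [h]
  · simp

theorem exists_eq_of_mem_colorSubmodule {V : Type} [Fintype V] [DecidableEq V]
    {G : SimpleGraph V} [DecidableRel G.Adj] {t : V → Bool}
    (hjoin : ∀ x y, t x ≠ t y → G.Adj x y) {X : Matrix V V ℝ}
    (hX : X ∈ colorSubmodule (pairColor G t)) :
    ∃ (g : Bool → Bool → ℝ) (p q : Bool → ℝ),
      X = Matrix.of (fun x y => g (t x) (t y)) + Matrix.diagonal (fun x => p (t x)) +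
        Matrix.diagonal (fun x => q (t x)) * classAdj G t := by
  obtain ⟨f, hf⟩ : ∃ f : Bool × Bool × Bool × Bool → ℝ,
      ∀ x y, X x y = f (pairColor G t x y) := by
    refine ⟨Function.extend (fun z : V × V => pairColor G t z.1 z.2) (fun z => X z.1 z.2) 0,
      fun x y => ?_⟩
    have : (fun z : V × V => X z.1 z.2).FactorsThrough
        (fun z : V × V => pairColor G t z.1 z.2) := fun a b h => hX _ _ _ _ h
    exact (this.extend_apply 0 (x, y)).symm
  refine ⟨fun a b => if a = b then f (a, b, false, false) else f (a, b, false, true),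
    fun a => f (a, a, true, false) - f (a, a, false, false),
    fun a => f (a, a, false, true) - f (a, a, false, false), ?_⟩
  ext x y
  rw [hf]
  simp only [Matrix.add_apply, Matrix.of_apply, Matrix.diagonal_mul, Matrix.diagonal_apply,
    classAdj, SimpleGraph.adjMatrix_apply, pairColor]
  by_cases hxy : x = y
  · subst hxy
    simp
  · by_cases ht : t x = t y
    · by_cases ha : G.Adj x y <;> simp [hxy, ht, ha]
    · have ha := hjoin x y ht
      simp [hxy, ht, ha, Ne.symm ht]

theorem pairColor_mul_mem {V : Type} [Fintype V] [DecidableEq V] {G : SimpleGraph V}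
    [DecidableRel G.Adj] {t : V → Bool} {k : Bool → ℝ}
    (hk : ∀ x, ∑ z, classAdj G t x z = k (t x))
    (hjoin : ∀ x y, t x ≠ t y → G.Adj x y)
    (hsq : G.adjMatrix ℝ * G.adjMatrix ℝ ∈ colorSubmodule (pairColor G t))
    {X Y : Matrix V V ℝ} (hX : X ∈ colorSubmodule (pairColor G t))
    (hY : Y ∈ colorSubmodule (pairColor G t)) : X * Y ∈ colorSubmodule (pairColor G t) := by
  set B := classAdj G t with hB
  have hGG : ∀ g g' : Bool → Bool → ℝ, Matrix.of (fun x y => g (t x) (t y)) *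
      Matrix.of (fun x y => g' (t x) (t y)) ∈ colorSubmodule (pairColor G t) := fun g g' =>
    pairColor_of_class_mem fun a b => ∑ z, g a (t z) * g' (t z) b
  have hBG : ∀ g : Bool → Bool → ℝ, B * Matrix.of (fun x y => g (t x) (t y)) ∈
      colorSubmodule (pairColor G t) := by
    intro g
    convert pairColor_of_class_mem (G := G) (t := t) fun a b => k a * g a b using 1
    ext x y
    simp only [Matrix.mul_apply, Matrix.of_apply]
    rw [← hk, Finset.sum_mul]
    exact Finset.sum_congr rfl fun z _ => classAdj_mul_apply x z fun a => g a (t y)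
  have hGB : ∀ g : Bool → Bool → ℝ, Matrix.of (fun x y => g (t x) (t y)) * B ∈
      colorSubmodule (pairColor G t) := by
    intro g
    convert pairColor_of_class_mem (G := G) (t := t) fun a b => g a b * k b using 1
    ext x y
    simp only [Matrix.mul_apply, Matrix.of_apply]
    rw [← hk, Finset.mul_sum]
    refine Finset.sum_congr rfl fun z _ => ?_
    rw [hB, classAdj_comm z y, mul_comm, classAdj_mul_apply y z fun a => g (t x) a, mul_comm]
  have hBD : ∀ p : Bool → ℝ, Matrix.diagonal (fun x => p (t x)) * B =
      B * Matrix.diagonal (fun x => p (t x)) := by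
    intro p
    ext x y
    rw [Matrix.diagonal_mul, Matrix.mul_diagonal, hB, classAdj_mul_apply, mul_comm]
  have hBB : B * B ∈ colorSubmodule (pairColor G t) := by
    have hA : G.adjMatrix ℝ = B + Matrix.of (fun x y => if t y = t x then (0 : ℝ) else 1) := by
      ext x y
      by_cases h : t y = t x
      · simp [hB, classAdj, h]
      · simp [hB, classAdj, h, hjoin x y (Ne.symm h)]
    set N : Matrix V V ℝ := Matrix.of (fun x y => if t y = t x then (0 : ℝ) else 1)
    have h1 : B * B = G.adjMatrix ℝ * G.adjMatrix ℝ - B * N - N * B - N * N := by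
      rw [hA]
      noncomm_ring
    rw [h1]
    exact Submodule.sub_mem _ (Submodule.sub_mem _ (Submodule.sub_mem _ hsq
      (hBG fun a b => if b = a then 0 else 1)) (hGB fun a b => if b = a then 0 else 1))
      (hGG (fun a b => if b = a then 0 else 1) fun a b => if b = a then 0 else 1)
  have hBmem : B ∈ colorSubmodule (pairColor G t) := pairColor_classAdj_mem
  obtain ⟨g, p, q, rfl⟩ := exists_eq_of_mem_colorSubmodule hjoin hX
  rw [add_mul, add_mul]
  refine Submodule.add_mem _ (Submodule.add_mem _ ?_ (pairColor_diagonal_mul_mem _ hY)) ?_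
  · obtain ⟨g', p', q', rfl⟩ := exists_eq_of_mem_colorSubmodule hjoin hY
    rw [mul_add, mul_add, ← hB, hBD q', ← mul_assoc]
    exact Submodule.add_mem _ (Submodule.add_mem _ (hGG _ _)
      (pairColor_mul_diagonal_mem _ (pairColor_of_class_mem _)))
      (pairColor_mul_diagonal_mem _ (hGB _))
  · rw [mul_assoc]
    refine pairColor_diagonal_mul_mem _ ?_
    obtain ⟨g', p', q', rfl⟩ := exists_eq_of_mem_colorSubmodule hjoin hY
    rw [mul_add, mul_add, ← hB, hBD q', ← mul_assoc]
    exact Submodule.add_mem _ (Submodule.add_mem _ (hBG _)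
      (pairColor_mul_diagonal_mem _ hBmem)) (pairColor_mul_diagonal_mem _ hBB)

theorem HasCoherentRank.le_card_image_pairColor {V : Type} [Fintype V] [DecidableEq V]
    {G : SimpleGraph V} [DecidableRel G.Adj] {n : ℕ} (hG : HasCoherentRank G n)
    {t : V → Bool} {k β : Bool → ℝ} {s p c : ℝ}
    (hk : ∀ x, ∑ z, classAdj G t x z = k (t x))
    (hjoin : ∀ x y, t x ≠ t y → G.Adj x y)
    (hsq : ∀ x y, (G.adjMatrix ℝ * G.adjMatrix ℝ) x y =
      s * G.adjMatrix ℝ x y - p * (if x = y then 1 else 0) + c * β (t x) * β (t y)) :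
    n ≤ (Finset.univ.image fun z : V × V => pairColor G t z.1 z.2).card := by
  refine hG.le_card_image _ ?_ ?_ ?_ pairColor_adjMatrix_mem
  · intro x y x' y' h
    rw [pairColor_eq_iff] at h ⊢
    rw [eq_comm (a := y), eq_comm (a := y'), G.adj_comm y, G.adj_comm y']
    tauto
  · intro x y y' h
    exact (pairColor_eq_iff.1 h).2.2.1.1 rfl
  · intro X hX Y hY
    refine pairColor_mul_mem hk hjoin ?_ hX hY
    intro x y x' y' h
    rw [hsq, hsq]
    rw [pairColor_eq_iff] at h
    simp only [SimpleGraph.adjMatrix_apply, h]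

theorem HasCoherentRank.le_three_of_regular {V : Type} [Fintype V] [DecidableEq V]
    {G : SimpleGraph V} [DecidableRel G.Adj] {n : ℕ} (hG : HasCoherentRank G n)
    (hconn : G.Connected)
    (h3 : ∃ t0 t1 t2 : ℝ, t0 ≠ t1 ∧ t0 ≠ t2 ∧ t1 ≠ t2 ∧
      {θ : ℝ | adjEig G θ} = {t0, t1, t2})
    {d : ℝ} (hd : ∀ x, ∑ z, G.adjMatrix ℝ x z = d) : n ≤ 3 := by
  obtain ⟨s, p, c, -, hsq⟩ := hconn.exists_adjMatrix_sq h3 (α := fun _ => 1) (l := d)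
    (fun _ => one_pos) (by
      ext x
      simpa [Matrix.mulVec, dotProduct, -SimpleGraph.adjMatrix_apply] using hd x)
  refine (hG.le_card_image_pairColor (t := fun _ => true) (k := fun _ => d) (β := fun _ => 1)
    (s := s) (p := p) (c := c) (by simpa [classAdj, -SimpleGraph.adjMatrix_apply] using hd)
    (by simp) hsq).trans ?_
  refine (Finset.card_le_card (t := {(true, true, true, false), (true, true, false, true),
    (true, true, false, false)}) ?_).trans Finset.card_le_three
  intro i hi
  obtain ⟨⟨x, y⟩, -, rfl⟩ := Finset.mem_image.1 hi
  by_cases hxy : x = y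
  · subst hxy; simp [pairColor]
  · by_cases ha : G.Adj x y <;> simp [pairColor, hxy, ha]

theorem exists_eigenvector_of_join {k n : Bool → ℝ} (hn : ∀ a, 0 < n a) :
    ∃ (β : Bool → ℝ) (l : ℝ), (∀ a, 0 < β a) ∧
      ∀ a, k a * β a + n (!a) * β (!a) = l * β a := by
  have hT := hn true
  have hF := hn false
  set D := (k true - k false) ^ 2 + 4 * n true * n false with hD
  have hlt : |k true - k false| < √D := by
    rw [← Real.sqrt_sq_eq_abs]
    exact Real.sqrt_lt_sqrt (sq_nonneg _) (by rw [hD]; nlinarith [mul_pos hT hF])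
  have hD0 : 0 ≤ D := by positivity
  have hsq : √D ^ 2 = D := Real.sq_sqrt hD0
  have hy : 0 < k false - k true + √D := by linarith [(abs_lt.1 hlt).2]
  refine ⟨fun a => if a then 2 * n false else k false - k true + √D,
    (k true + k false + √D) / 2, ?_, ?_⟩
  · rintro (_ | _)
    · simpa using hy
    · simpa using hF
  · rintro (_ | _)
    · simp only [Bool.not_false, if_true, Bool.false_eq_true, if_false]
      linear_combination (-1 / 2) * hsq - hD / 2
    · simp only [Bool.not_true, if_true, Bool.false_eq_true, if_false]
      ring

theorem sum_adjMatrix_mul_of_join {V : Type} [Fintype V] {G : SimpleGraph V}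
    [DecidableRel G.Adj] {t : V → Bool} {k : Bool → ℝ}
    (hk : ∀ x, ∑ z, classAdj G t x z = k (t x))
    (hjoin : ∀ x y, t x ≠ t y → G.Adj x y) (f : Bool → ℝ) (x : V) :
    ∑ z, G.adjMatrix ℝ x z * f (t z) =
      k (t x) * f (t x) + (∑ z, if t z = !(t x) then (1 : ℝ) else 0) * f (!(t x)) := by
  rw [← hk, Finset.sum_mul, Finset.sum_mul, ← Finset.sum_add_distrib]
  refine Finset.sum_congr rfl fun z _ => ?_
  by_cases h : t z = t x
  · simp [classAdj, h]
  · have h' : t z = !(t x) := by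
      revert h; cases t z <;> cases t x <;> simp
    simp [classAdj, h', hjoin x z (Ne.symm h)]

theorem adjMatrix_mul_self_apply_of_ne_class {V : Type} [Fintype V] {G : SimpleGraph V}
    [DecidableRel G.Adj] {t : V → Bool} {k : Bool → ℝ}
    (hk : ∀ x, ∑ z, classAdj G t x z = k (t x))
    (hjoin : ∀ x y, t x ≠ t y → G.Adj x y) {x y : V} (hxy : t x ≠ t y) :
    (G.adjMatrix ℝ * G.adjMatrix ℝ) x y = k (t x) + k (t y) := by
  rw [← hk, ← hk, ← Finset.sum_add_distrib, Matrix.mul_apply]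
  refine Finset.sum_congr rfl fun z _ => ?_
  by_cases h : t z = t x
  · have h' : t z ≠ t y := h ▸ hxy
    simp [classAdj, h, hxy, SimpleGraph.adjMatrix_apply, hjoin z y h']
  · have h' : t z = t y := by
      revert h hxy; cases t z <;> cases t x <;> cases t y <;> simp
    simp [classAdj, h', hxy.symm, SimpleGraph.adjMatrix_apply, hjoin x z (Ne.symm h), G.adj_comm]

theorem adjMatrix_mul_self_apply_self {V : Type} [Fintype V] {G : SimpleGraph V}
    [DecidableRel G.Adj] (x : V) :
    (G.adjMatrix ℝ * G.adjMatrix ℝ) x x = ∑ z, G.adjMatrix ℝ x z := by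
  rw [Matrix.mul_apply]
  refine Finset.sum_congr rfl fun z _ => ?_
  by_cases h : G.Adj x z <;> simp [SimpleGraph.adjMatrix_apply, h, G.adj_comm z x]

theorem adjMatrix_mul_self_apply_of_clique {V : Type} [Fintype V] [DecidableEq V]
    {G : SimpleGraph V} [DecidableRel G.Adj] {t : V → Bool}
    (hjoin : ∀ x y, t x ≠ t y → G.Adj x y) {a : Bool}
    (hcl : ∀ x y, t x = a → t y = a → x ≠ y → G.Adj x y) {x y : V} (hx : t x = a) (hy : t y = a)
    (hxy : x ≠ y) :
    (G.adjMatrix ℝ * G.adjMatrix ℝ) x y = ∑ z, G.adjMatrix ℝ x z - 1 := by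
  have h1 : (∑ z, if z = y then (1 : ℝ) else 0) = 1 := by simp
  rw [← h1, ← Finset.sum_sub_distrib, Matrix.mul_apply]
  have hall : ∀ w z, t w = a → w ≠ z → G.Adj w z := by
    intro w z hw hwz
    by_cases hz : t z = a
    · exact hcl w z hw hz hwz
    · exact hjoin w z (by rw [hw]; exact Ne.symm hz)
  refine Finset.sum_congr rfl fun z _ => ?_
  simp only [SimpleGraph.adjMatrix_apply, G.adj_comm z y]
  by_cases hzy : z = y
  · subst hzy
    simp [hall x z hx hxy]
  · have := hall y z hy (Ne.symm hzy)
    simp [this, hzy]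

theorem adjMatrix_mul_self_apply_of_coclique {V : Type} [Fintype V]
    {G : SimpleGraph V} [DecidableRel G.Adj] {t : V → Bool}
    (hjoin : ∀ x y, t x ≠ t y → G.Adj x y) {a : Bool}
    (hco : ∀ x y, t x = a → t y = a → ¬ G.Adj x y) {x y : V} (hx : t x = a) (hy : t y = a) :
    (G.adjMatrix ℝ * G.adjMatrix ℝ) x y = ∑ z, G.adjMatrix ℝ x z := by
  rw [Matrix.mul_apply]
  refine Finset.sum_congr rfl fun z _ => ?_
  by_cases hz : t z = a
  · simp [SimpleGraph.adjMatrix_apply, hco x z hx hz]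
  · simp [SimpleGraph.adjMatrix_apply, hjoin z y (by rw [hy]; exact hz)]

/-- The colours that can occur in a join. -/
def joinColors : Finset (Bool × Bool × Bool × Bool) :=
  Finset.univ.filter fun i => (i.2.2.1 = true → i.1 = i.2.1 ∧ i.2.2.2 = false) ∧
    (i.1 ≠ i.2.1 → i.2.2.2 = true)

theorem card_joinColors : joinColors.card = 8 := by decide

theorem pairColor_mem_joinColors {V : Type} [DecidableEq V]
    {G : SimpleGraph V} [DecidableRel G.Adj] {t : V → Bool}
    (hjoin : ∀ x y, t x ≠ t y → G.Adj x y) (x y : V) : pairColor G t x y ∈ joinColors := by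
  simp only [joinColors, Finset.mem_filter, Finset.mem_univ, true_and, pairColor,
    decide_eq_true_eq, decide_eq_false_iff_not]
  exact ⟨by rintro rfl; exact ⟨rfl, G.irrefl⟩, hjoin x y⟩

theorem exists_missing_color {V : Type} [Fintype V] [DecidableEq V]
    {G : SimpleGraph V} [DecidableRel G.Adj] {t : V → Bool}
    (hjoin : ∀ x y, t x ≠ t y → G.Adj x y) (hne : ∀ a, ∃ x, t x = a)
    (hle : (Finset.univ.image fun z : V × V => pairColor G t z.1 z.2).card ≤ 7)
    (hge : 7 ≤ (Finset.univ.image fun z : V × V => pairColor G t z.1 z.2).card) :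
    ∃ a, ((∀ x y, t x = a → t y = a → ¬ G.Adj x y) ∧
        (∃ x y, t x = a ∧ t y = a ∧ x ≠ y) ∧
        (∃ x y, t x = !a ∧ t y = !a ∧ G.Adj x y)) ∨
      ((∀ x y, t x = a → t y = a → x ≠ y → G.Adj x y) ∧
        (∃ x y, t x = a ∧ t y = a ∧ x ≠ y) ∧
        (∃ x y, t x = !a ∧ t y = !a ∧ x ≠ y ∧ ¬ G.Adj x y)) := by
  set I := Finset.univ.image fun z : V × V => pairColor G t z.1 z.2 with hI
  have hmemI : ∀ x y, pairColor G t x y ∈ I := fun x y =>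
    Finset.mem_image.2 ⟨(x, y), Finset.mem_univ _, rfl⟩
  have hIS : I ⊆ joinColors := by
    intro i hi
    obtain ⟨⟨x, y⟩, -, rfl⟩ := Finset.mem_image.1 hi
    exact pairColor_mem_joinColors hjoin x y
  have htwo : ∀ i ∈ joinColors, ∀ j ∈ joinColors, i ≠ j → i ∉ I → j ∈ I := by
    intro i hi j hj hij hiI
    by_contra hjI
    have hsub : I ⊆ (joinColors.erase i).erase j := fun x hx =>
      Finset.mem_erase.2 ⟨fun h => hjI (h ▸ hx), Finset.mem_erase.2
        ⟨fun h => hiI (h ▸ hx), hIS hx⟩⟩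
    have h1 := Finset.card_le_card hsub
    rw [Finset.card_erase_of_mem (Finset.mem_erase.2 ⟨hij.symm, hj⟩),
      Finset.card_erase_of_mem hi, card_joinColors] at h1
    omega
  obtain ⟨i, hiS, hiI⟩ : ∃ i ∈ joinColors, i ∉ I := by
    by_contra! h
    have := Finset.card_le_card h
    rw [card_joinColors] at this
    omega
  have hadjI : ∀ a, (a, a, false, true) ∈ I → ∃ x y, t x = a ∧ t y = a ∧ G.Adj x y := by
    intro a ha
    obtain ⟨⟨x, y⟩, -, h⟩ := Finset.mem_image.1 ha
    simp only [pairColor, Prod.mk.injEq, decide_eq_true_eq] at h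
    exact ⟨x, y, h.1, h.2.1, h.2.2.2⟩
  have hnadjI : ∀ a, (a, a, false, false) ∈ I →
      ∃ x y, t x = a ∧ t y = a ∧ x ≠ y ∧ ¬ G.Adj x y := by
    intro a ha
    obtain ⟨⟨x, y⟩, -, h⟩ := Finset.mem_image.1 ha
    simp only [pairColor, Prod.mk.injEq, decide_eq_false_iff_not] at h
    exact ⟨x, y, h.1, h.2.1, h.2.2.1, h.2.2.2⟩
  have hmem : ∀ b d, (b, b, false, d) ∈ joinColors := by decide
  have hcases : ∀ i ∈ joinColors, ∃ a, i = (a, a, true, false) ∨ i = (a, !a, false, true) ∨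
      i = (a, a, false, true) ∨ i = (a, a, false, false) := by decide
  obtain ⟨a, rfl | rfl | rfl | rfl⟩ := hcases i hiS
  · obtain ⟨x, hx⟩ := hne a
    exact absurd (by simpa [pairColor, hx] using hmemI x x) hiI
  · obtain ⟨x, hx⟩ := hne a
    obtain ⟨y, hy⟩ := hne (!a)
    have hxy : t x ≠ t y := by rw [hx, hy]; cases a <;> simp
    have h := hmemI x y
    rw [pairColor, hx, hy, decide_eq_false (fun h : x = y => hxy (congrArg t h)),
      decide_eq_true (hjoin x y hxy)] at h
    exact absurd h hiI
  · obtain ⟨x, y, hx, hy, hxy, -⟩ := hnadjI a (htwo _ hiS _ (hmem _ _) (by simp) hiI)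
    refine ⟨a, Or.inl ⟨fun u v hu hv huv => hiI ?_, ⟨x, y, hx, hy, hxy⟩,
      hadjI _ (htwo _ hiS _ (hmem _ _) (by cases a <;> simp) hiI)⟩⟩
    have := hmemI u v
    rwa [pairColor, hu, hv, decide_eq_false huv.ne, decide_eq_true huv] at this
  · obtain ⟨x, y, hx, hy, hxy⟩ := hadjI a (htwo _ hiS _ (hmem _ _) (by simp) hiI)
    refine ⟨a, Or.inr ⟨fun u v hu hv huv => ?_, ⟨x, y, hx, hy, hxy.ne⟩,
      hnadjI _ (htwo _ hiS _ (hmem _ _) (by cases a <;> simp) hiI)⟩⟩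
    by_contra hnadj
    have := hmemI u v
    rw [pairColor, hu, hv, decide_eq_false huv, decide_eq_false hnadj] at this
    exact hiI this

/-- A graph of coherent rank `7` with three eigenvalues is not a join of two regular graphs
whose pairs of vertices have at most seven colours. -/
theorem HasCoherentRank.join_false {V : Type} [Fintype V] [DecidableEq V]
    {G : SimpleGraph V} [DecidableRel G.Adj] (hG : HasCoherentRank G 7)
    (hconn : G.Connected)
    (h3 : ∃ t0 t1 t2 : ℝ, t0 ≠ t1 ∧ t0 ≠ t2 ∧ t1 ≠ t2 ∧
      {θ : ℝ | adjEig G θ} = {t0, t1, t2})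
    {t : V → Bool} {k : Bool → ℝ}
    (hk : ∀ x, ∑ z, classAdj G t x z = k (t x))
    (hjoin : ∀ x y, t x ≠ t y → G.Adj x y) (hne : ∀ a, ∃ x, t x = a)
    (hcard : (Finset.univ.image fun z : V × V => pairColor G t z.1 z.2).card ≤ 7) : False := by
  set n : Bool → ℝ := fun a => ∑ z, if t z = a then (1 : ℝ) else 0 with hn
  have hnpos : ∀ a, 0 < n a := by
    intro a
    obtain ⟨x, hx⟩ := hne a
    refine Finset.sum_pos' (fun z _ => by split_ifs <;> norm_num) ⟨x, Finset.mem_univ _, ?_⟩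
    rw [if_pos hx]
    exact one_pos
  obtain ⟨β, l, hβ, hβl⟩ := exists_eigenvector_of_join (k := k) hnpos
  have hrow := sum_adjMatrix_mul_of_join hk hjoin
  have hdeg : ∀ x, ∑ z, G.adjMatrix ℝ x z = k (t x) + n (!(t x)) := by
    intro x
    simpa only [mul_one] using hrow (fun _ => 1) x
  obtain ⟨s, p, c, hc, hsq⟩ := hconn.exists_adjMatrix_sq h3 (α := fun x => β (t x)) (l := l)
    (fun x => hβ _) (by
      ext x
      exact (hrow β x).trans (hβl _))
  have hdiag : ∀ a, k a + n (!a) = c * β a * β a - p := by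
    intro a
    obtain ⟨x, rfl⟩ := hne a
    have := hsq x x
    rw [adjMatrix_mul_self_apply_self, hdeg] at this
    simp at this
    linarith
  have hcross : ∀ a, k a + k (!a) = s + c * β a * β (!a) := by
    intro a
    obtain ⟨x, hx⟩ := hne a
    obtain ⟨y, hy⟩ := hne (!a)
    have hxy : t x ≠ t y := by rw [hx, hy]; cases a <;> simp
    have := hsq x y
    rw [adjMatrix_mul_self_apply_of_ne_class hk hjoin hxy, hx, hy] at this
    have hne' : x ≠ y := fun h => hxy (h ▸ rfl)
    simp [hne', hjoin x y hxy] at this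
    linarith
  have hcoclique : ∀ a, (∀ x y, t x = a → t y = a → ¬ G.Adj x y) →
      (∃ x y, t x = a ∧ t y = a ∧ x ≠ y) → (∃ x y, t x = !a ∧ t y = !a ∧ G.Adj x y) →
      False := by
    rintro a hco ⟨x, y, hx, hy, hxy⟩ ⟨u, v, hu, hv, huv⟩
    have h1 := hsq x y
    rw [adjMatrix_mul_self_apply_of_coclique hjoin hco hx hy, hdeg, hx, hy] at h1
    simp [hco x y hx hy, hxy] at h1
    have hka : k a = 0 := by
      rw [← hx, ← hk]
      refine Finset.sum_eq_zero fun z _ => ?_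
      by_cases hz : t z = t x
      · simp [classAdj, hco x z hx (hz.trans hx)]
      · simp [classAdj, hz]
    have hkb : 0 < k (!a) := by
      rw [← hu, ← hk]
      refine Finset.sum_pos' (fun z _ => ?_) ⟨v, Finset.mem_univ _, ?_⟩
      · simp only [classAdj, Matrix.of_apply, SimpleGraph.adjMatrix_apply]
        split_ifs <;> norm_num
      · simp [classAdj, hu, hv, huv]
    have hda := hdiag a
    have hdb := hdiag (!a)
    have hla := hβl a
    have hlb := hβl (!a)
    rw [Bool.not_not] at hdb hlb
    have hβa := hβ a
    have hp : p = 0 := by linarith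
    rw [hka] at h1 hla
    have hl : l = c * β a * β (!a) := by
      refine mul_right_cancel₀ hβa.ne' ?_
      linear_combination -hla + β (!a) * h1
    have hββ : β a = β (!a) := by
      refine mul_left_cancel₀ hkb.ne' ?_
      linear_combination β a * hdb - hlb - β a * hp - β (!a) * hl
    have hreg : ∀ b, k b + n (!b) = k a + n (!a) := by
      intro b
      have hb : b = a ∨ b = !a := by cases a <;> cases b <;> simp
      rcases hb with rfl | rfl
      · rfl
      · rw [hdiag, hdiag, hββ]
    have := hG.le_three_of_regular hconn h3 fun x => (hdeg x).trans (hreg _)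
    omega
  have hclique : ∀ a, (∀ x y, t x = a → t y = a → x ≠ y → G.Adj x y) →
      (∃ x y, t x = a ∧ t y = a ∧ x ≠ y) →
      (∃ x y, t x = !a ∧ t y = !a ∧ x ≠ y ∧ ¬ G.Adj x y) → False := by
    rintro a hcl ⟨x, y, hx, hy, hxy⟩ ⟨u, v, hu, hv, huv, hadj⟩
    have h1 := hsq x y
    rw [adjMatrix_mul_self_apply_of_clique hjoin hcl hx hy hxy, hdeg, hx, hy] at h1
    simp [hcl x y hx hy hxy, hxy] at h1
    have hka : k a = n a - 1 := by
      have h1 : (∑ z, if z = x then (1 : ℝ) else 0) = 1 := by simp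
      rw [← hx, ← hk, ← h1, hn, ← Finset.sum_sub_distrib]
      refine Finset.sum_congr rfl fun z _ => ?_
      by_cases hzx : z = x
      · subst hzx; simp [classAdj]
      · by_cases hz : t z = t x
        · simp [classAdj, hz, hzx, hcl x z hx (hz.trans hx) (Ne.symm hzx)]
        · simp [classAdj, hz, hzx]
    have hkb : k (!a) ≤ n (!a) - 2 := by
      have h1 : (∑ z, if z = u then (1 : ℝ) else 0) = 1 := by simp
      have h2 : (∑ z, if z = v then (1 : ℝ) else 0) = 1 := by simp
      have h3 : n (!a) - 2 = ∑ z, ((if t z = !a then (1 : ℝ) else 0) -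
          (if z = u then (1 : ℝ) else 0) - (if z = v then (1 : ℝ) else 0)) := by
        rw [Finset.sum_sub_distrib, Finset.sum_sub_distrib, h1, h2]
        ring
      rw [h3]
      nth_rw 1 [← hu]
      rw [← hk]
      refine Finset.sum_le_sum fun z _ => ?_
      by_cases hzu : z = u
      · subst hzu; simp [classAdj, hu, huv]
      · by_cases hzv : z = v
        · subst hzv; simp [classAdj, hv, hzu, hadj]
        · simp only [classAdj, Matrix.of_apply, SimpleGraph.adjMatrix_apply, hu, hzu, hzv,
            if_false, sub_zero]
          split_ifs <;> norm_num
    have hda := hdiag a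
    have hdb := hdiag (!a)
    have hcr := hcross a
    rw [Bool.not_not] at hdb
    have hββ : β a = β (!a) := by
      refine mul_left_cancel₀ (mul_ne_zero hc (hβ (!a)).ne') ?_
      linear_combination hdb - hcr + hka - hda + h1
    rw [← hββ] at hdb
    linarith
  have hmissing := exists_missing_color hjoin hne hcard
    (hG.le_card_image_pairColor hk hjoin hsq)
  obtain ⟨a, ⟨h1, h2, h3⟩ | ⟨h1, h2, h3⟩⟩ := hmissing
  · exact hcoclique a h1 h2 h3
  · exact hclique a h1 h2 h3

theorem card_image_le_of_factors {V ι : Type} [Fintype V] [DecidableEq ι] {n : ℕ}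
    {c : V → V → Fin n} {κ : V → V → ι}
    (h : ∀ x y x' y', c x y = c x' y' → κ x y = κ x' y') :
    (Finset.univ.image fun z : V × V => κ z.1 z.2).card ≤ n := by
  set I := Finset.univ.image fun z : V × V => κ z.1 z.2
  have hex : ∀ i : I, ∃ x y, κ x y = i := by
    intro i
    obtain ⟨z, -, hz⟩ := Finset.mem_image.1 i.2
    exact ⟨z.1, z.2, hz⟩
  choose u v huv using hex
  have hinj : Function.Injective fun i => c (u i) (v i) := fun i j hij =>
    Subtype.ext (by rw [← huv i, ← huv j]; exact h _ _ _ _ hij)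
  simpa using Fintype.card_le_of_injective _ hinj

/-- No connected graph whose adjacency matrix has exactly three distinct real eigenvalues has
coherent rank equal to `7`. -/
theorem stmt4 {V : Type} [Fintype V] [DecidableEq V] (G : SimpleGraph V) [DecidableRel G.Adj]
    (hconn : G.Connected)
    (h3 : ∃ t0 t1 t2 : ℝ, t0 ≠ t1 ∧ t0 ≠ t2 ∧ t1 ≠ t2 ∧
      {θ : ℝ | adjEig G θ} = {t0, t1, t2}) :
    ¬ HasCoherentRank G 7 := by
  intro hG
  obtain ⟨c, hc, hdeg⟩ := hG.exists_coloring
  obtain ⟨x₀⟩ := hconn.nonempty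
  by_cases hone : ∀ x, c x x = c x₀ x₀
  · have hreg : ∀ x, ∑ z, G.adjMatrix ℝ x z = ∑ z, G.adjMatrix ℝ x₀ z := by
      intro x
      simpa only [hone, if_true] using hdeg x₀ x x₀ (hone x)
    have := hG.le_three_of_regular hconn h3 hreg
    omega
  push Not at hone
  obtain ⟨y₀, hy₀⟩ := hone
  have htwo : ∀ x, c x x = c x₀ x₀ ∨ c x x = c y₀ y₀ := by
    by_contra! h
    obtain ⟨z₀, hz₀, hz₁⟩ := h
    let f : Fin 3 → V := ![x₀, y₀, z₀]
    have hf : ∀ i j, c (f i) (f i) = c (f j) (f j) → i = j := by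
      intro i j
      fin_cases i <;> fin_cases j <;> simp [f, hy₀, hz₀, hz₁, hy₀.symm, hz₀.symm, hz₁.symm]
    have hinj : Function.Injective fun z : Fin 3 × Fin 3 => c (f z.1) (f z.2) := by
      intro z w h
      have h' := hc _ _ _ _ h
      exact Prod.ext (hf _ _ h'.1) (hf _ _ h'.2.1)
    have := Fintype.card_le_of_injective _ hinj
    simp at this
  let t : V → Bool := fun x => decide (c x x = c x₀ x₀)
  have ht : ∀ x y, t x = t y ↔ c x x = c y y := by
    intro x y
    rcases htwo x with hx | hx <;> rcases htwo y with hy | hy <;>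
      simp [t, hx, hy, hy₀, hy₀.symm]
  have hne : ∀ a, ∃ x, t x = a := by
    rintro (_ | _)
    · exact ⟨y₀, by simp [t, hy₀]⟩
    · exact ⟨x₀, by simp [t]⟩
  have hdeg' : ∀ u x x', t x = t x' → ∑ z, (if t z = t u then G.adjMatrix ℝ x z else 0) =
      ∑ z, (if t z = t u then G.adjMatrix ℝ x' z else 0) := by
    intro u x x' h
    simpa only [ht] using hdeg u x x' ((ht _ _).1 h)
  have hcross : ∀ a, ∀ x, t x = a → ∃ y, t y = !a ∧ G.Adj x y := by
    intro a x hx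
    obtain ⟨y, hy⟩ := hne (!a)
    obtain ⟨p⟩ := hconn.preconnected x y
    obtain ⟨d, -, hd1, hd2⟩ := p.exists_boundary_dart {z | t z = a} hx
      (by simp [hy])
    have hd2' : t d.snd = !a := by
      simp only [Set.mem_ofPred_eq] at hd2
      revert hd2
      cases t d.snd <;> cases a <;> simp
    have h := hdeg' d.snd d.fst x (hd1.trans hx.symm)
    have hpos : 0 < ∑ z, (if t z = t d.snd then G.adjMatrix ℝ d.fst z else 0) := by
      refine Finset.sum_pos' (fun z _ => ?_) ⟨d.snd, Finset.mem_univ _, ?_⟩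
      · rw [SimpleGraph.adjMatrix_apply]
        split_ifs <;> norm_num
      · simp [SimpleGraph.adjMatrix_apply, d.adj]
    rw [h] at hpos
    obtain ⟨z, -, hz⟩ := Finset.exists_ne_zero_of_sum_ne_zero hpos.ne'
    refine ⟨z, ?_, ?_⟩
    · by_contra hz'
      rw [← hd2'] at hz'
      simp [hz'] at hz
    · by_contra hz'
      simp [SimpleGraph.adjMatrix_apply, hz'] at hz
  have hjoin : ∀ x y, t x ≠ t y → G.Adj x y := by
    intro x y hxy
    by_contra hadj
    obtain ⟨y', hy', hxy'⟩ := hcross _ x rfl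
    obtain ⟨x', hx', hyx'⟩ := hcross _ y rfl
    have hty : t y = !(t x) := by
      revert hxy; cases t x <;> cases t y <;> simp
    rw [hty, Bool.not_not] at hx'
    have hyy' : y ≠ y' := fun h => hadj (h ▸ hxy')
    have hxx' : x ≠ x' := fun h => hadj (h ▸ hyx'.symm)
    let κ : V → V → Bool × Bool × Bool := fun u v =>
      (t u, t v, if t u = t v then decide (u = v) else decide (G.Adj u v))
    have hκ := card_image_le_of_factors (c := c) (κ := κ) (by
      intro u v u' v' h
      obtain ⟨h1, h2, h3, h4⟩ := hc _ _ _ _ h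
      rw [← ht] at h1 h2
      simp only [κ, h1, h2, h3, h4])
    have hall : (Finset.univ.image fun z : V × V => κ z.1 z.2) = Finset.univ := by
      have hadj' : ¬ G.Adj y x := fun h => hadj h.symm
      have hmem : ∀ i, (∃ u v, κ u v = i) →
          i ∈ Finset.univ.image fun z : V × V => κ z.1 z.2 := by
        rintro i ⟨u, v, h⟩
        exact Finset.mem_image.2 ⟨(u, v), Finset.mem_univ _, h⟩
      have hmain : ∀ a d, ∃ u v, κ u v = (t x, a, d) := by
        intro a d
        by_cases ha : a = t x
        · subst ha
          cases d
          · exact ⟨x, x', by simp [κ, hx', hxx']⟩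
          · exact ⟨x, x, by simp [κ]⟩
        · have ha' : a = !(t x) := by revert ha; cases a <;> cases t x <;> simp
          subst ha'
          cases d
          · exact ⟨x, y, by simp [κ, hty, hadj]⟩
          · exact ⟨x, y', by simp [κ, hy', hxy']⟩
      have hmain' : ∀ a d, ∃ u v, κ u v = (!(t x), a, d) := by
        intro a d
        by_cases ha : a = t x
        · subst ha
          cases d
          · exact ⟨y, x, by simp [κ, hty, hadj']⟩
          · exact ⟨y, x', by simp [κ, hx', hty, hyx']⟩
        · have ha' : a = !(t x) := by revert ha; cases a <;> cases t x <;> simp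
          subst ha'
          cases d
          · exact ⟨y, y', by simp [κ, hy', hty, hyy']⟩
          · exact ⟨y, y, by simp [κ, hty]⟩
      refine Finset.eq_univ_of_forall ?_
      rintro ⟨a, b, d⟩
      refine hmem _ ?_
      by_cases ha : a = t x
      · exact ha ▸ hmain b d
      · have ha' : a = !(t x) := by revert ha; cases a <;> cases t x <;> simp
        exact ha' ▸ hmain' b d
    rw [hall] at hκ
    simp at hκ
  choose w hw using hne
  refine hG.join_false hconn h3 (t := t) (k := fun a => ∑ z, classAdj G t (w a) z) ?_ hjoin
    (fun a => ⟨w a, hw a⟩) (card_image_le_of_factors (c := c) ?_)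
  · intro x
    have := hdeg' x x (w (t x)) (hw _).symm
    simpa only [classAdj, Matrix.of_apply, hw] using this
  · intro x y x' y' h
    rw [pairColor_eq_iff, ht, ht]
    exact hc _ _ _ _ h
end

section
/- Let Γ ∈ 𝒢₃(θ0,θ1,θ2) have coherent rank 8. Then there exist a positive integer λ and a partition of the vertex set of Γ into sets V1 and V2 with |V1| = |V2| = λ³ − λ + 1 such that V1 is an independent set of Γ, V2 is a clique of Γ, and the V1×V2 biadjacency matrix M of Γ (the {0,1}-matrix with rows indexed by V1 and columns by V2 recording adjacency) has every row sum and every column sum equal to λ² and satisfies M·Mᵀ = (λ² − λ)·I + λ·J; that is, M is the incidence matrix of a symmetric 2-(λ³−λ+1, λ², λ) design. -/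
open Matrix

/-- `Γ ∈ 𝒢₃(θ0,θ1,θ2)`: `Γ` is connected and the set of eigenvalues of its adjacency
matrix is exactly `{θ0, θ1, θ2}`, where `θ0 > θ1 > θ2`. -/
def InG3 {V : Type} [Fintype V] [DecidableEq V] (G : SimpleGraph V) [DecidableRel G.Adj]
    (θ0 θ1 θ2 : ℝ) : Prop :=
  G.Connected ∧ θ1 < θ0 ∧ θ2 < θ1 ∧ {θ : ℝ | adjEig G θ} = {θ0, θ1, θ2}

namespace SimpleGraph

variable {V : Type} [Fintype V] [DecidableEq V] {G : SimpleGraph V} [DecidableRel G.Adj]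

omit [Fintype V] [DecidableEq V] in
theorem isHermitian_adjMatrix_real (G : SimpleGraph V) [DecidableRel G.Adj] :
    (G.adjMatrix ℝ).IsHermitian := by
  simp [Matrix.IsHermitian, Matrix.conjTranspose_eq_transpose_of_trivial]

theorem adjEig_of_isHermitian_eigenvalues (i : V) :
    adjEig G ((isHermitian_adjMatrix_real G).eigenvalues i) := by
  refine ⟨(isHermitian_adjMatrix_real G).eigenvectorBasis i, fun h0 => ?_,
    (isHermitian_adjMatrix_real G).mulVec_eigenvectorBasis i⟩
  apply (isHermitian_adjMatrix_real G).eigenvectorBasis.toBasis.ne_zero i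
  ext x
  simpa using congrFun h0 x

/-- The cubic polynomial with roots the three eigenvalues annihilates the adjacency matrix. -/
theorem cubic_adjMatrix_eq_zero {θ0 θ1 θ2 : ℝ}
    (h : ∀ θ, adjEig G θ → θ = θ0 ∨ θ = θ1 ∨ θ = θ2) :
    (G.adjMatrix ℝ - θ0 • 1) * ((G.adjMatrix ℝ - θ1 • 1) * (G.adjMatrix ℝ - θ2 • 1)) = 0 := by
  have hA := isHermitian_adjMatrix_real G
  set φ := Unitary.conjStarAlgAut ℝ (Matrix V V ℝ) hA.eigenvectorUnitary with hφ
  have hs : ∀ t : ℝ, G.adjMatrix ℝ - t • 1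
      = φ (Matrix.diagonal fun i => hA.eigenvalues i - t) := by
    intro t
    have h1 : (Matrix.diagonal fun i => hA.eigenvalues i - t)
        = Matrix.diagonal (RCLike.ofReal ∘ hA.eigenvalues) - t • (1 : Matrix V V ℝ) := by
      ext x y
      by_cases hxy : x = y
      · subst hxy; simp
      · simp [hxy]
    rw [h1, map_sub, map_smul, map_one, hφ, ← hA.spectral_theorem]
  rw [hs, hs, hs, ← map_mul, ← map_mul, Matrix.diagonal_mul_diagonal,
    Matrix.diagonal_mul_diagonal]
  convert map_zero φ
  ext x y
  by_cases hxy : x = y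
  · subst hxy
    rcases h _ (adjEig_of_isHermitian_eigenvalues x) with h | h | h <;> simp [h]
  · simp [hxy]

theorem posSemidef_sub_adjMatrix {θ0 : ℝ} (h : ∀ θ, adjEig G θ → θ ≤ θ0) :
    (θ0 • 1 - G.adjMatrix ℝ).PosSemidef := by
  have hB : (θ0 • 1 - G.adjMatrix ℝ).IsHermitian :=
    (Matrix.isHermitian_one.smul (IsSelfAdjoint.all θ0)).sub (isHermitian_adjMatrix_real G)
  rw [hB.posSemidef_iff_eigenvalues_nonneg]
  intro i
  have hv := hB.mulVec_eigenvectorBasis i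
  have : adjEig G (θ0 - hB.eigenvalues i) := by
    refine ⟨hB.eigenvectorBasis i, fun h0 => ?_, ?_⟩
    · apply hB.eigenvectorBasis.toBasis.ne_zero i
      ext x
      simpa using congrFun h0 x
    · rw [Matrix.sub_mulVec, Matrix.smul_mulVec, Matrix.one_mulVec] at hv
      rw [sub_smul, ← hv, sub_sub_cancel]
  simpa using h _ this

/-- For the largest eigenvalue, the absolute value of an eigenvector is an eigenvector. -/
theorem adjMatrix_mulVec_abs {θ0 : ℝ} (h : ∀ θ, adjEig G θ → θ ≤ θ0) {f : V → ℝ}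
    (hf : G.adjMatrix ℝ *ᵥ f = θ0 • f) : G.adjMatrix ℝ *ᵥ |f| = θ0 • |f| := by
  have hp := posSemidef_sub_adjMatrix h
  have key : |f| ⬝ᵥ ((θ0 • 1 - G.adjMatrix ℝ) *ᵥ |f|) = 0 := by
    refine le_antisymm ?_ (hp.dotProduct_mulVec_nonneg |f|)
    have h0 : f ⬝ᵥ ((θ0 • 1 - G.adjMatrix ℝ) *ᵥ f) = 0 := by
      simp [Matrix.sub_mulVec, hf, Matrix.smul_mulVec]
    rw [← h0]
    simp only [Matrix.sub_mulVec, Matrix.smul_mulVec, Matrix.one_mulVec, dotProduct_sub,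
      dotProduct_smul]
    have h1 : |f| ⬝ᵥ |f| = f ⬝ᵥ f := by simp [dotProduct]
    have h2 : f ⬝ᵥ (G.adjMatrix ℝ *ᵥ f) ≤ |f| ⬝ᵥ (G.adjMatrix ℝ *ᵥ |f|) := by
      simp only [dotProduct, Matrix.mulVec, Finset.mul_sum]
      refine Finset.sum_le_sum fun i _ => Finset.sum_le_sum fun j _ => ?_
      rw [adjMatrix_apply]
      split_ifs
      · simpa [abs_mul] using le_abs_self (f i * f j)
      · simp
    rw [h1]
    linarith
  have := (hp.dotProduct_mulVec_zero_iff |f|).1 (by simpa using key)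
  rw [Matrix.sub_mulVec, Matrix.smul_mulVec, Matrix.one_mulVec, sub_eq_zero] at this
  exact this.symm

theorem eq_zero_of_adjMatrix_mulVec_eq {θ0 : ℝ} (hG : G.Connected)
    (h : ∀ θ, adjEig G θ → θ ≤ θ0) {f : V → ℝ}
    (hf : G.adjMatrix ℝ *ᵥ f = θ0 • f) {x : V} (hx : f x = 0) : f = 0 := by
  have step : ∀ u v, G.Adj u v → f u = 0 → f v = 0 := by
    intro u v huv hu
    have h1 := congrFun (adjMatrix_mulVec_abs h hf) u
    rw [adjMatrix_mulVec_apply] at h1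
    simp only [Pi.smul_apply, Pi.abs_apply, hu, abs_zero, smul_zero] at h1
    rw [Finset.sum_eq_zero_iff_of_nonneg (fun _ _ => abs_nonneg _)] at h1
    simpa using h1 v (by simpa using huv)
  ext y
  obtain ⟨p⟩ := hG.preconnected x y
  induction p with
  | nil => exact hx
  | cons huv _ ih => exact ih (step _ _ huv hx)

theorem exists_perron {θ0 θ1 θ2 : ℝ} (h : InG3 G θ0 θ1 θ2) :
    ∃ α : V → ℝ, (∀ x, 0 < α x) ∧
      G.adjMatrix ℝ * G.adjMatrix ℝ
        = (θ1 + θ2) • G.adjMatrix ℝ - (θ1 * θ2) • 1 + Matrix.vecMulVec α α := by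
  obtain ⟨hG, h10, h21, hset⟩ := h
  have hmem : ∀ θ, adjEig G θ ↔ θ = θ0 ∨ θ = θ1 ∨ θ = θ2 := by
    intro θ
    simpa using Set.ext_iff.1 hset θ
  have hle : ∀ θ, adjEig G θ → θ ≤ θ0 := by
    intro θ hθ
    rcases (hmem θ).1 hθ with h | h | h <;> linarith
  obtain ⟨g, hg0, hg⟩ := (hmem θ0).2 (Or.inl rfl)
  set A := G.adjMatrix ℝ with hAdef
  set f : V → ℝ := |g| with hfdef
  have hf : A *ᵥ f = θ0 • f := adjMatrix_mulVec_abs hle hg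
  have hfpos : ∀ x, 0 < f x := by
    intro x
    refine abs_pos.2 fun hx => hg0 (eq_zero_of_adjMatrix_mulVec_eq hG hle hg hx)
  set N : Matrix V V ℝ := (A - θ1 • 1) * (A - θ2 • 1) with hN
  have hAN : A * N = θ0 • N := by
    have := cubic_adjMatrix_eq_zero fun θ => (hmem θ).1
    rw [← hN, sub_mul, smul_mul_assoc, one_mul, sub_eq_zero] at this
    exact this
  have hNexp : N = A * A - (θ1 + θ2) • A + (θ1 * θ2) • 1 := by
    simp only [hN, sub_mul, mul_sub, smul_mul_assoc, mul_smul_comm, one_mul, mul_one]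
    module
  have hNsymm : Nᵀ = N := by
    rw [hNexp]
    simp [hAdef]
  obtain ⟨x0⟩ := hG.nonempty
  have hcol : ∀ x y, N x y = N x0 y / f x0 * f x := by
    intro x y
    have := eq_zero_of_adjMatrix_mulVec_eq hG hle (x := x0)
      (f := N.col y - (N x0 y / f x0) • f) ?_ ?_
    · have := congrFun this x
      simp [sub_eq_zero] at this
      exact this
    · have h1 : A *ᵥ N.col y = θ0 • N.col y := by
        ext z
        exact congrFun (congrFun hAN z) y
      rw [Matrix.mulVec_sub, Matrix.mulVec_smul, hf, h1]
      module
    · have := (hfpos x0).ne'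
      simp
      field_simp
      simp
  set κ := N x0 x0 / f x0 / f x0 with hκ
  have hNκ : ∀ x y, N x y = κ * f x * f y := by
    intro x y
    rw [hcol x y, show N x0 y = N y x0 from congrFun (congrFun hNsymm y) x0 ▸ rfl, hcol y x0, hκ]
    ring
  have hNf : N *ᵥ f = ((θ0 - θ1) * (θ0 - θ2)) • f := by
    rw [hNexp, Matrix.add_mulVec, Matrix.sub_mulVec, ← Matrix.mulVec_mulVec, hf, Matrix.mulVec_smul,
      hf, Matrix.smul_mulVec, Matrix.smul_mulVec, hf, Matrix.one_mulVec]
    module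
  have hκpos : 0 < κ := by
    have h1 := congrFun hNf x0
    simp only [Matrix.mulVec, dotProduct, hNκ, Pi.smul_apply, smul_eq_mul] at h1
    have h2 : 0 < (θ0 - θ1) * (θ0 - θ2) * f x0 :=
      mul_pos (mul_pos (by linarith) (by linarith)) (hfpos x0)
    rw [← h1] at h2
    by_contra hneg
    push Not at hneg
    refine absurd h2 (not_lt.2 (Finset.sum_nonpos fun y _ => ?_))
    have := mul_pos (mul_pos (hfpos x0) (hfpos y)) (hfpos y)
    nlinarith
  refine ⟨fun x => √κ * f x, fun x => mul_pos (Real.sqrt_pos.2 hκpos) (hfpos x), ?_⟩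
  have : Matrix.vecMulVec (fun x => √κ * f x) (fun x => √κ * f x) = N := by
    ext x y
    rw [Matrix.vecMulVec_apply, hNκ]
    linear_combination f x * f y * Real.mul_self_sqrt hκpos.le
  rw [this, hNexp]
  module

end SimpleGraph

namespace IsCoherentConfig

variable {V : Type} [Fintype V] [DecidableEq V] {r : ℕ} {W : Fin r → Matrix V V ℝ}

theorem exists_color (hW : IsCoherentConfig W) :
    ∃ c : V → V → Fin r, ∀ i x y, W i x y = if c x y = i then 1 else 0 := by
  obtain ⟨h01, hJ, -⟩ := hW
  have hsum : ∀ x y, ∑ i, W i x y = 1 := by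
    intro x y
    simpa [Matrix.sum_apply] using congrFun (congrFun hJ x) y
  have hex : ∀ x y, ∃ i, W i x y = 1 := by
    intro x y
    by_contra! hne
    have := hsum x y
    rw [Finset.sum_eq_zero fun i _ => (h01 i x y).resolve_right (hne i)] at this
    exact zero_ne_one this
  choose c hc using hex
  refine ⟨c, fun i x y => ?_⟩
  split_ifs with hi
  · rw [← hi, hc]
  · refine (h01 i x y).resolve_right fun h1 => ?_
    have h2 : ∑ j ∈ {c x y, i}, W j x y ≤ 1 := by
      rw [← hsum x y]
      refine Finset.sum_le_sum_of_subset_of_nonneg (Finset.subset_univ _) fun j _ _ => ?_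
      rcases h01 j x y with h | h <;> simp [h]
    rw [Finset.sum_pair hi, hc, h1] at h2
    norm_num at h2

theorem mul_mem_span (hW : IsCoherentConfig W) {M N : Matrix V V ℝ}
    (hM : M ∈ Submodule.span ℝ (Set.range W)) (hN : N ∈ Submodule.span ℝ (Set.range W)) :
    M * N ∈ Submodule.span ℝ (Set.range W) := by
  have h : Submodule.span ℝ (Set.range W) * Submodule.span ℝ (Set.range W)
      ≤ Submodule.span ℝ (Set.range W) := by
    rw [Submodule.span_mul_span, Submodule.span_le]
    rintro _ ⟨_, ⟨i, rfl⟩, _, ⟨j, rfl⟩, rfl⟩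
    exact hW.2.2.2.2 i j
  exact h (Submodule.mul_mem_mul hM hN)

theorem one_mem_span (hW : IsCoherentConfig W) : 1 ∈ Submodule.span ℝ (Set.range W) := by
  obtain ⟨Δ, hΔ⟩ := hW.2.2.2.1
  rw [← hΔ]
  exact Submodule.sum_mem _ fun i _ => Submodule.subset_span ⟨i, rfl⟩

theorem allOnes_mem_span (hW : IsCoherentConfig W) :
    (Matrix.of fun _ _ => (1 : ℝ)) ∈ Submodule.span ℝ (Set.range W) := by
  rw [← hW.2.1]
  exact Submodule.sum_mem _ fun i _ => Submodule.subset_span ⟨i, rfl⟩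

variable {c : V → V → Fin r}

omit [Fintype V] [DecidableEq V] in
theorem apply_eq_of_color_eq (hc : ∀ i x y, W i x y = if c x y = i then 1 else 0)
    {N : Matrix V V ℝ} (hN : N ∈ Submodule.span ℝ (Set.range W)) {x y x' y' : V}
    (h : c x y = c x' y') : N x y = N x' y' := by
  induction hN using Submodule.span_induction with
  | mem M hM =>
    obtain ⟨i, rfl⟩ := hM
    rw [hc, hc, h]
  | zero => rfl
  | add M N _ _ hM hN => rw [Matrix.add_apply, Matrix.add_apply, hM, hN]
  | smul a M _ hM => rw [Matrix.smul_apply, Matrix.smul_apply, hM]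

theorem eq_of_color_eq_diag (hW : IsCoherentConfig W)
    (hc : ∀ i x y, W i x y = if c x y = i then 1 else 0) {x y z : V} (h : c x y = c z z) :
    x = y := by
  have := apply_eq_of_color_eq hc hW.one_mem_span h
  by_contra hne
  simp [hne] at this

theorem color_left (hW : IsCoherentConfig W)
    (hc : ∀ i x y, W i x y = if c x y = i then 1 else 0) {x y x' y' : V} (h : c x y = c x' y') :
    c x x = c x' x' := by
  have h1 := apply_eq_of_color_eq hc (hW.mul_mem_span
    (Submodule.subset_span ⟨c x x, rfl⟩) hW.allOnes_mem_span) h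
  simp only [Matrix.mul_apply, hc, Matrix.of_apply, mul_one] at h1
  by_contra hne
  rw [Finset.sum_eq_zero (s := Finset.univ) (f := fun z => if c x' z = c x x then (1 : ℝ) else 0)]
    at h1
  · have h2 := Finset.single_le_sum (s := Finset.univ) (a := x)
      (f := fun z => if c x z = c x x then (1 : ℝ) else 0)
      (fun z _ => by split_ifs <;> norm_num) (Finset.mem_univ x)
    rw [h1] at h2
    norm_num at h2
  · intro z _
    rw [if_neg]
    intro hz
    have := hW.eq_of_color_eq_diag hc hz
    subst this
    exact hne hz.symm

theorem color_right (hW : IsCoherentConfig W)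
    (hc : ∀ i x y, W i x y = if c x y = i then 1 else 0) {x y x' y' : V} (h : c x y = c x' y') :
    c y y = c y' y' := by
  have h1 := apply_eq_of_color_eq hc (hW.mul_mem_span
    hW.allOnes_mem_span (Submodule.subset_span ⟨c y y, rfl⟩)) h
  simp only [Matrix.mul_apply, hc, Matrix.of_apply, one_mul] at h1
  by_contra hne
  rw [Finset.sum_eq_zero (s := Finset.univ) (f := fun z => if c z y' = c y y then (1 : ℝ) else 0)]
    at h1
  · have h2 := Finset.single_le_sum (s := Finset.univ) (a := y)
      (f := fun z => if c z y = c y y then (1 : ℝ) else 0)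
      (fun z _ => by split_ifs <;> norm_num) (Finset.mem_univ y)
    rw [h1] at h2
    norm_num at h2
  · intro z _
    rw [if_neg]
    intro hz
    have := hW.eq_of_color_eq_diag hc hz
    subst this
    exact hne hz.symm

end IsCoherentConfig

/-- `V1, V2` is a partition into two nonempty parts, equitable for the matrix `A`: the sum of the
entries of a row of `V_i` over the columns of `V_j` is `kij`. -/
structure IsEquitable {V : Type} (A : Matrix V V ℝ) (V1 V2 : Finset V) (k11 k12 k21 k22 : ℝ) :
    Prop where
  mem_right : ∀ x, x ∈ V2 ↔ x ∉ V1
  nonempty_left : V1.Nonempty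
  nonempty_right : V2.Nonempty
  sum₁₁ : ∀ x ∈ V1, ∑ z ∈ V1, A x z = k11
  sum₁₂ : ∀ x ∈ V1, ∑ z ∈ V2, A x z = k12
  sum₂₁ : ∀ x ∈ V2, ∑ z ∈ V1, A x z = k21
  sum₂₂ : ∀ x ∈ V2, ∑ z ∈ V2, A x z = k22

theorem IsEquitable.symm {V : Type} {A : Matrix V V ℝ} {V1 V2 : Finset V} {k11 k12 k21 k22 : ℝ}
    (h : IsEquitable A V1 V2 k11 k12 k21 k22) : IsEquitable A V2 V1 k22 k21 k12 k11 :=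
  ⟨fun x => by rw [h.mem_right, not_not], h.nonempty_right, h.nonempty_left, h.sum₂₂, h.sum₂₁,
    h.sum₁₂, h.sum₁₁⟩

namespace IsCoherentConfig

variable {V : Type} [Fintype V] [DecidableEq V] {r : ℕ} {W : Fin r → Matrix V V ℝ}
  {c : V → V → Fin r}

theorem sum_fibre_eq (hW : IsCoherentConfig W)
    (hc : ∀ i x y, W i x y = if c x y = i then 1 else 0) {A : Matrix V V ℝ}
    (hA : A ∈ Submodule.span ℝ (Set.range W)) (u : V) {x x' : V} (h : c x x = c x' x') :
    ∑ z with c z z = c u u, A x z = ∑ z with c z z = c u u, A x' z := by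
  have h1 := apply_eq_of_color_eq hc (hW.mul_mem_span hA (hW.mul_mem_span
    (Submodule.subset_span ⟨c u u, rfl⟩) hW.allOnes_mem_span)) h
  have h2 : ∀ z w, (W (c u u) * (Matrix.of fun _ _ => (1 : ℝ)) : Matrix V V ℝ) z w
      = if c z z = c u u then 1 else 0 := by
    intro z w
    simp only [Matrix.mul_apply, hc, Matrix.of_apply, mul_one]
    rw [Finset.sum_eq_single z]
    · intro v _ hv
      exact if_neg fun h => hv (hW.eq_of_color_eq_diag hc h).symm
    · simp
  rw [Matrix.mul_apply, Matrix.mul_apply] at h1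
  simpa only [h2, mul_ite, mul_one, mul_zero, ← Finset.sum_filter] using h1

/-- A symmetric 0-1 matrix with non-constant row sums in a coherent configuration of rank `8` gives
rise to two fibres. Unless the off-diagonal block is constant, the diagonal blocks are trivial. -/
theorem exists_isEquitable {W : Fin 8 → Matrix V V ℝ} (hW : IsCoherentConfig W)
    {A : Matrix V V ℝ} (hA : A ∈ Submodule.span ℝ (Set.range W)) (hsymm : ∀ x y, A x y = A y x)
    (h01 : ∀ x y, A x y = 0 ∨ A x y = 1) {x0 y0 : V} (hxy : ∑ z, A x0 z ≠ ∑ z, A y0 z) :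
    ∃ V1 V2 k11 k12 k21 k22, IsEquitable A V1 V2 k11 k12 k21 k22 ∧
      ((∀ x ∈ V1, ∀ y ∈ V2, ∀ x' ∈ V1, ∀ y' ∈ V2, A x y = A x' y') ∨
        ∃ e1 e2 : ℝ, (e1 = 0 ∨ e1 = 1) ∧ (e2 = 0 ∨ e2 = 1) ∧
          (∀ x ∈ V1, ∀ y ∈ V1, x ≠ y → A x y = e1) ∧
          (∀ x ∈ V2, ∀ y ∈ V2, x ≠ y → A x y = e2)) := by
  obtain ⟨c, hc⟩ := hW.exists_color
  have hc0 : c x0 x0 ≠ c y0 y0 := by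
    intro h
    have h1 := apply_eq_of_color_eq hc (hW.mul_mem_span hA hW.allOnes_mem_span) h
    simp only [Matrix.mul_apply, Matrix.of_apply, mul_one] at h1
    exact hxy h1
  have htwo : ∀ z, c z z = c x0 x0 ∨ c z z = c y0 y0 := by
    intro z
    by_contra! hz
    have hinj : Function.Injective fun p : Fin 3 × Fin 3 => c (![x0, y0, z] p.1)
        (![x0, y0, z] p.2) := by
      have hv : ∀ i j : Fin 3, c (![x0, y0, z] i) (![x0, y0, z] i)
          = c (![x0, y0, z] j) (![x0, y0, z] j) → i = j := by
        intro i j h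
        fin_cases i <;> fin_cases j <;> simp_all [eq_comm]
      rintro ⟨i, j⟩ ⟨i', j'⟩ h
      rw [hv i i' (hW.color_left hc h), hv j j' (hW.color_right hc h)]
    simpa using Fintype.card_le_of_injective _ hinj
  set V1 : Finset V := Finset.univ.filter fun z => c z z = c x0 x0 with hV1
  set V2 : Finset V := Finset.univ.filter fun z => c z z = c y0 y0 with hV2
  have hm1 : ∀ z, z ∈ V1 ↔ c z z = c x0 x0 := by simp [hV1]
  have hm2 : ∀ z, z ∈ V2 ↔ c z z = c y0 y0 := by simp [hV2]
  have hm12 : ∀ z, z ∈ V2 ↔ z ∉ V1 := by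
    intro z
    rw [hm1, hm2]
    rcases htwo z with h | h
    · simp [h, hc0]
    · simp [h, hc0.symm]
  have hEq : IsEquitable A V1 V2 (∑ z ∈ V1, A x0 z) (∑ z ∈ V2, A x0 z) (∑ z ∈ V1, A y0 z)
      (∑ z ∈ V2, A y0 z) := by
    refine ⟨hm12, ⟨x0, (hm1 _).2 rfl⟩, ⟨y0, (hm2 _).2 rfl⟩, fun x hx => ?_, fun x hx => ?_,
      fun x hx => ?_, fun x hx => ?_⟩
    · exact hW.sum_fibre_eq hc hA _ ((hm1 _).1 hx)
    · exact hW.sum_fibre_eq hc hA _ ((hm1 _).1 hx)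
    · exact hW.sum_fibre_eq hc hA _ ((hm2 _).1 hx)
    · exact hW.sum_fibre_eq hc hA _ ((hm2 _).1 hx)
  clear_value V1 V2
  clear hV1 hV2
  refine ⟨V1, V2, _, _, _, _, hEq, or_iff_not_imp_left.2 fun hne => ?_⟩
  push Not at hne
  obtain ⟨x, hx, y, hy, x', hx', y', hy', hne⟩ := hne
  obtain ⟨p, hp, p', hp', hpp⟩ : ∃ p ∈ V1, ∃ p' ∈ V1, p ≠ p' := by
    by_contra! hone
    have h1 : V1 = {x} := Finset.eq_singleton_iff_unique_mem.2 ⟨hx, fun z hz => hone z hz x hx⟩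
    have h2 := (hEq.sum₂₁ y hy).trans (hEq.sum₂₁ y' hy').symm
    rw [h1, Finset.sum_singleton, Finset.sum_singleton] at h2
    rw [hone x' hx' x hx, hsymm x y, hsymm x y'] at hne
    exact hne h2
  obtain ⟨q, hq, q', hq', hqq⟩ : ∃ q ∈ V2, ∃ q' ∈ V2, q ≠ q' := by
    by_contra! hone
    have h1 : V2 = {y} := Finset.eq_singleton_iff_unique_mem.2 ⟨hy, fun z hz => hone z hz y hy⟩
    have h2 := (hEq.sum₁₂ x hx).trans (hEq.sum₁₂ x' hx').symm
    rw [h1, Finset.sum_singleton, Finset.sum_singleton] at h2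
    rw [hone y' hy' y hy] at hne
    exact hne h2
  have hside : ∀ {u v u' v'}, c u v = c u' v' → (u ∈ V1 ↔ u' ∈ V1) ∧ (v ∈ V1 ↔ v' ∈ V1) := by
    intro u v u' v' h
    simp only [hm1]
    rw [hW.color_left hc h, hW.color_right hc h]
    exact ⟨Iff.rfl, Iff.rfl⟩
  rw [hm12] at hy hy' hq hq'
  have hcol1 : c x y ≠ c x' y' := fun h => hne (apply_eq_of_color_eq hc hA h)
  have hcol2 : c y x ≠ c y' x' := fun h => hne <| by
    rw [hsymm x y, hsymm x' y']
    exact apply_eq_of_color_eq hc hA h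
  have hcol3 : c p p' ≠ c p p := fun h => hpp (hW.eq_of_color_eq_diag hc h)
  have hcol4 : c q q' ≠ c q q := fun h => hqq (hW.eq_of_color_eq_diag hc h)
  let g : Fin 8 → Fin 8 :=
    ![c x y, c x' y', c y x, c y' x', c p p, c p p', c q q, c q q']
  have hinj : Function.Injective g := by
    intro i j h
    fin_cases i <;> fin_cases j <;> first
      | rfl
      | exact absurd h hcol1
      | exact absurd h.symm hcol1
      | exact absurd h hcol2
      | exact absurd h.symm hcol2
      | exact absurd h hcol3
      | exact absurd h.symm hcol3
      | exact absurd h hcol4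
      | exact absurd h.symm hcol4
      | (exfalso; simpa [hx, hx', hy, hy', hp, hp', hq, hq'] using hside h)
  have hsurj : Function.Surjective g := Finite.injective_iff_surjective.1 hinj
  refine ⟨A p p', A q q', h01 _ _, h01 _ _, fun u hu v hv huv => ?_, fun u hu v hv huv => ?_⟩
  · obtain ⟨i, hi⟩ := hsurj (c u v)
    fin_cases i <;> first
      | exact (apply_eq_of_color_eq hc hA hi).symm
      | (exfalso; exact huv (hW.eq_of_color_eq_diag hc (Eq.symm hi)))
      | (exfalso; simpa [hx, hx', hy, hy', hp, hp', hq, hq', hu, hv] using hside hi)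
  · rw [hm12] at hu hv
    obtain ⟨i, hi⟩ := hsurj (c u v)
    fin_cases i <;> first
      | exact (apply_eq_of_color_eq hc hA hi).symm
      | (exfalso; exact huv (hW.eq_of_color_eq_diag hc (Eq.symm hi)))
      | (exfalso; simpa [hx, hx', hy, hy', hp, hp', hq, hq', hu, hv] using hside hi)

end IsCoherentConfig

theorem isCoherentConfig_of_regular {V : Type} [Fintype V] [DecidableEq V] {A : Matrix V V ℝ}
    (h01 : ∀ x y, A x y = 0 ∨ A x y = 1) (hsymm : Aᵀ = A) (hdiag : ∀ x, A x x = 0) {k s p q : ℝ}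
    (hk : ∀ x, ∑ y, A x y = k)
    (hsq : A * A = s • A + p • 1 + q • Matrix.of fun _ _ => 1) :
    IsCoherentConfig ![1, A, (Matrix.of fun _ _ => 1) - 1 - A] := by
  set J : Matrix V V ℝ := Matrix.of fun _ _ => 1 with hJ
  have hAJ : A * J = k • J := by
    ext x y
    simp [Matrix.mul_apply, hJ, hk]
  have hJA : J * A = k • J := by
    have h := congrArg Matrix.transpose hAJ
    have hJt : Jᵀ = J := by ext; simp [hJ]
    rwa [Matrix.transpose_mul, Matrix.transpose_smul, hsymm, hJt] at h
  have hJJ : J * J = (Fintype.card V : ℝ) • J := by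
    ext x y
    simp [Matrix.mul_apply, hJ]
  refine ⟨fun i x y => ?_, ?_, fun i => ?_, ⟨{0}, by simp⟩, fun i j => ?_⟩
  · fin_cases i
    · by_cases hxy : x = y <;> simp [hxy]
    · exact h01 x y
    · by_cases hxy : x = y
      · subst hxy; simp [hJ, hdiag]
      · rcases h01 x y with h | h <;> simp [hJ, hxy, h]
  · simp [Fin.sum_univ_three, hJ]
  · have hJt : Jᵀ = J := by ext; simp [hJ]
    refine ⟨i, ?_⟩
    fin_cases i <;> simp [hsymm, hJt]
  · set S := Submodule.span ℝ (Set.range ![1, A, J - 1 - A]) with hS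
    have h1 : 1 ∈ S := Submodule.subset_span ⟨0, rfl⟩
    have hA : A ∈ S := Submodule.subset_span ⟨1, rfl⟩
    have hJS : J ∈ S := by
      have h2 : J - 1 - A ∈ S := Submodule.subset_span ⟨2, rfl⟩
      simpa using S.add_mem (S.add_mem h2 hA) h1
    have hadd : ∀ X Y, X ∈ S → Y ∈ S → X + Y ∈ S := fun _ _ => S.add_mem
    have hsub : ∀ X Y, X ∈ S → Y ∈ S → X - Y ∈ S := fun _ _ => S.sub_mem
    have hsmul : ∀ (a : ℝ) X, X ∈ S → a • X ∈ S := fun a _ => S.smul_mem a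
    clear_value S J
    fin_cases i <;> fin_cases j <;>
      simp only [Fin.zero_eta, Fin.mk_one, Fin.reduceFinMk, Matrix.cons_val, mul_sub, sub_mul,
        one_mul, mul_one, hAJ, hJA, hJJ, hsq] <;>
      repeat' first
        | assumption
        | with_reducible apply hadd
        | with_reducible apply hsub
        | with_reducible apply hsmul

set_option maxHeartbeats 1000000 in
/-- The join of a complete or edgeless graph and a strongly regular graph has coherent rank at
most `7`. -/
theorem exists_isCoherentConfig_of_join {V : Type} [Fintype V] [DecidableEq V] {A : Matrix V V ℝ}
    {V1 V2 : Finset V} {k11 k12 k21 k22 : ℝ} (hE : IsEquitable A V1 V2 k11 k12 k21 k22)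
    (hsymm : ∀ x y, A x y = A y x) (h01 : ∀ x y, A x y = 0 ∨ A x y = 1)
    (hdiag : ∀ x, A x x = 0) (hcross : ∀ x ∈ V1, ∀ y ∈ V2, A x y = 1) {e : ℝ}
    (he : ∀ x ∈ V1, ∀ y ∈ V1, x ≠ y → A x y = e) {s p q : ℝ}
    (hsq : ∀ x ∈ V2, ∀ y ∈ V2, ∑ z ∈ V2, A x z * A z y
      = s * A x y + p * (if x = y then 1 else 0) + q) :
    ∃ W : Fin 7 → Matrix V V ℝ, IsCoherentConfig W ∧ A ∈ Submodule.span ℝ (Set.range W) := by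
  have hm := hE.mem_right
  set u1 : V → ℝ := fun x => if x ∈ V1 then 1 else 0 with hu1
  set u2 : V → ℝ := fun x => if x ∈ V2 then 1 else 0 with hu2
  obtain ⟨P1, hP1⟩ : ∃ P, P = Matrix.diagonal u1 := ⟨_, rfl⟩
  obtain ⟨P2, hP2⟩ : ∃ P, P = Matrix.diagonal u2 := ⟨_, rfl⟩
  obtain ⟨B, hB⟩ : ∃ B : Matrix V V ℝ, B = Matrix.of fun x y => u2 x * A x y * u2 y := ⟨_, rfl⟩
  have hP11 : P1 * P1 = P1 := by
    rw [hP1, Matrix.diagonal_mul_diagonal]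
    congr 1; ext x; simp [hu1]
  have hP22 : P2 * P2 = P2 := by
    rw [hP2, Matrix.diagonal_mul_diagonal]
    congr 1; ext x; simp [hu2]
  have hP12 : P1 * P2 = 0 := by
    rw [hP1, hP2, Matrix.diagonal_mul_diagonal, ← Matrix.diagonal_zero]
    congr 1; ext x; by_cases hx : x ∈ V1 <;> simp [hu1, hu2, hm, hx]
  have hP21 : P2 * P1 = 0 := by
    rw [hP1, hP2, Matrix.diagonal_mul_diagonal, ← Matrix.diagonal_zero]
    congr 1; ext x; by_cases hx : x ∈ V1 <;> simp [hu1, hu2, hm, hx]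
  have hP1B : P1 * B = 0 := by
    ext x y; by_cases hx : x ∈ V1 <;> simp [hP1, hB, hu1, hu2, hm, hx]
  have hBP1 : B * P1 = 0 := by
    ext x y; by_cases hy : y ∈ V1 <;> simp [hP1, hB, hu1, hu2, hm, hy]
  have hP2B : P2 * B = B := by
    ext x y; by_cases hx : x ∈ V1 <;> simp [hP2, hB, hu2, hm, hx]
  have hBP2 : B * P2 = B := by
    ext x y; by_cases hy : y ∈ V1 <;> simp [hP2, hB, hu2, hm, hy]
  have hP1u1 : P1 *ᵥ u1 = u1 := by ext x; simp [hP1, Matrix.mulVec_diagonal, hu1]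
  have hP1u2 : P1 *ᵥ u2 = 0 := by
    ext x; by_cases hx : x ∈ V1 <;> simp [hP1, Matrix.mulVec_diagonal, hu1, hu2, hm, hx]
  have hP2u2 : P2 *ᵥ u2 = u2 := by ext x; simp [hP2, Matrix.mulVec_diagonal, hu2]
  have hP2u1 : P2 *ᵥ u1 = 0 := by
    ext x; by_cases hx : x ∈ V1 <;> simp [hP2, Matrix.mulVec_diagonal, hu1, hu2, hm, hx]
  have hBu1 : B *ᵥ u1 = 0 := by
    ext x
    refine Finset.sum_eq_zero fun y _ => ?_
    by_cases hy : y ∈ V1 <;> simp [hB, hu1, hu2, hm, hy]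
  have hBu2 : B *ᵥ u2 = k22 • u2 := by
    ext x
    by_cases hx : x ∈ V2
    · simpa [Matrix.mulVec, dotProduct, hB, hu2, hx] using hE.sum₂₂ x hx
    · simp [Matrix.mulVec, dotProduct, hB, hu2, hx]
  have hP1t : P1ᵀ = P1 := by rw [hP1, Matrix.diagonal_transpose]
  have hP2t : P2ᵀ = P2 := by rw [hP2, Matrix.diagonal_transpose]
  have hBt : Bᵀ = B := by
    ext x y
    simp only [hB, Matrix.transpose_apply, Matrix.of_apply, hsymm x y]
    ring
  have hvec : ∀ {M : Matrix V V ℝ}, Mᵀ = M → ∀ u, u ᵥ* M = M *ᵥ u := by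
    intro M hM u
    rw [← Matrix.mulVec_transpose, hM]
  have hBB : B * B = s • B + p • P2 + q • Matrix.vecMulVec u2 u2 := by
    ext x y
    by_cases hx : x ∈ V2
    · by_cases hy : y ∈ V2
      · have := hsq x hx y hy
        simp [Matrix.mul_apply, hB, hu2, hx, hy, hP2, Matrix.vecMulVec_apply, Matrix.diagonal_apply, this]
      · have hxy : x ≠ y := fun h => hy (h ▸ hx)
        simp [Matrix.mul_apply, hB, hu2, hy, hP2, Matrix.vecMulVec_apply, hxy]
    · simp [Matrix.mul_apply, hB, hu2, hx, hP2, Matrix.vecMulVec_apply, Matrix.diagonal_apply]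
  have hu12 : u1 ⬝ᵥ u2 = 0 :=
    Finset.sum_eq_zero fun x _ => by by_cases hx : x ∈ V1 <;> simp [hu1, hu2, hm, hx]
  have hu21 : u2 ⬝ᵥ u1 = 0 := by rw [dotProduct_comm, hu12]
  set W : Fin 7 → Matrix V V ℝ := ![P1, Matrix.vecMulVec u1 u1 - P1, P2, B,
    Matrix.vecMulVec u2 u2 - P2 - B, Matrix.vecMulVec u1 u2, Matrix.vecMulVec u2 u1] with hW
  set S := Submodule.span ℝ (Set.range W) with hS
  have mP1 : P1 ∈ S := Submodule.subset_span ⟨0, rfl⟩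
  have mP2 : P2 ∈ S := Submodule.subset_span ⟨2, rfl⟩
  have mB : B ∈ S := Submodule.subset_span ⟨3, rfl⟩
  have m12 : Matrix.vecMulVec u1 u2 ∈ S := Submodule.subset_span ⟨5, rfl⟩
  have m21 : Matrix.vecMulVec u2 u1 ∈ S := Submodule.subset_span ⟨6, rfl⟩
  have m11 : Matrix.vecMulVec u1 u1 ∈ S := by
    have h2 : Matrix.vecMulVec u1 u1 - P1 ∈ S := Submodule.subset_span ⟨1, rfl⟩
    simpa using S.add_mem h2 mP1
  have m22 : Matrix.vecMulVec u2 u2 ∈ S := by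
    have h2 : Matrix.vecMulVec u2 u2 - P2 - B ∈ S := Submodule.subset_span ⟨4, rfl⟩
    simpa using S.add_mem (S.add_mem h2 mB) mP2
  refine ⟨W, ⟨fun i x y => ?_, ?_, fun i => ?_, ⟨{0, 2}, ?_⟩, fun i j => ?_⟩, ?_⟩
  · have hxy := h01 x y
    have hd := hdiag x
    by_cases hx : x ∈ V1 <;> by_cases hy : y ∈ V1 <;> by_cases he : x = y <;>
      first
        | (obtain rfl := he
           fin_cases i <;> simp [hW, hP1, hP2, hB, hu1, hu2, hm, hx, hd, Matrix.vecMulVec_apply])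
        | (rcases hxy with h | h <;> fin_cases i <;>
            simp [hW, hP1, hP2, hB, hu1, hu2, hm, hx, hy, he, h, Matrix.vecMulVec_apply])
  · ext x y
    simp only [Fin.sum_univ_seven, hW, Matrix.cons_val]
    by_cases hx : x ∈ V1 <;> by_cases hy : y ∈ V1 <;>
      simp [hu1, hu2, hm, hx, hy, Matrix.vecMulVec_apply]
  · refine ⟨![0, 1, 2, 3, 4, 6, 5] i, ?_⟩
    fin_cases i <;>
      simp [hW, Matrix.transpose_vecMulVec, hP1t, hP2t, hBt]
  · rw [Finset.sum_pair (by decide)]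
    ext x y
    by_cases hx : x ∈ V1 <;>
      simp [hW, hP1, hP2, hu1, hu2, hm, hx, Matrix.diagonal_apply, Matrix.one_apply]
  · rw [← hS]
    have hadd : ∀ X Y, X ∈ S → Y ∈ S → X + Y ∈ S := fun _ _ => S.add_mem
    have hsub : ∀ X Y, X ∈ S → Y ∈ S → X - Y ∈ S := fun _ _ => S.sub_mem
    have hneg : ∀ X, X ∈ S → -X ∈ S := fun _ => S.neg_mem
    have hsmul : ∀ (a : ℝ) X, X ∈ S → a • X ∈ S := fun a _ => S.smul_mem a
    clear_value S u1 u2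
    fin_cases i <;> fin_cases j <;>
      simp only [hW, Fin.zero_eta, Fin.mk_one, Fin.reduceFinMk, Matrix.cons_val, mul_sub, sub_mul,
        hP11, hP12, hP21, hP22, hP1B, hBP1, hP2B, hBP2, hBB, Matrix.mul_vecMulVec,
        Matrix.vecMulVec_mul, hvec hP1t, hvec hP2t, hvec hBt, hP1u1, hP1u2, hP2u1, hP2u2, hBu1,
        hBu2, Matrix.vecMulVec_mulVec, hu12, hu21, Matrix.zero_vecMulVec,
        Matrix.vecMulVec_zero, Matrix.smul_vecMulVec, Matrix.vecMulVec_smul,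
        MulOpposite.op_zero, zero_smul, op_smul_eq_smul, sub_self] <;>
      repeat' first
        | assumption
        | exact S.zero_mem
        | with_reducible apply hadd
        | with_reducible apply hsub
        | with_reducible apply hneg
        | with_reducible apply hsmul
  · have hdec : A = e • (Matrix.vecMulVec u1 u1 - P1) + B + Matrix.vecMulVec u1 u2
        + Matrix.vecMulVec u2 u1 := by
      ext x y
      by_cases hx : x ∈ V1 <;> by_cases hy : y ∈ V1
      · by_cases hxy : x = y
        · subst hxy
          simp [hP1, hB, hu1, hu2, hm, hx, Matrix.vecMulVec_apply, hdiag]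
        · simp [hP1, hB, hu1, hu2, hm, hx, hy, hxy, Matrix.vecMulVec_apply, he x hx y hy hxy]
      · have hxy : x ≠ y := fun h => hy (h ▸ hx)
        simp [hP1, hB, hu1, hu2, hm, hx, hy, Matrix.vecMulVec_apply, hxy,
          hcross x hx y ((hm y).2 hy)]
      · simp [hP1, hB, hu1, hu2, hm, hx, hy, Matrix.vecMulVec_apply, Matrix.diagonal_apply,
          hsymm x y, hcross y hy x ((hm x).2 hx)]
      · simp [hP1, hB, hu1, hu2, hm, hx, hy, Matrix.vecMulVec_apply, Matrix.diagonal_apply]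
    rw [hdec]
    exact S.add_mem (S.add_mem (S.add_mem (S.smul_mem _ (S.sub_mem m11 mP1)) mB) m12) m21

/-- A symmetric `{0,1}`-matrix `A` with zero diagonal and an equitable partition `V1, V2` such that
`A ^ 2 = s A + p I + α αᵀ` for a vector `α` equal to `a1 > 0` on `V1` and to `a2 > 0` on `V2`. -/
structure IsBiregular {V : Type} [Fintype V] [DecidableEq V] (A : Matrix V V ℝ) (V1 V2 : Finset V)
    (k11 k12 k21 k22 s p a1 a2 : ℝ) : Prop extends IsEquitable A V1 V2 k11 k12 k21 k22 where
  apply_comm : ∀ x y, A x y = A y x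
  zero_or_one : ∀ x y, A x y = 0 ∨ A x y = 1
  apply_self : ∀ x, A x x = 0
  pos_left : 0 < a1
  pos_right : 0 < a2
  eq₁₁ : ∀ x ∈ V1, ∀ y ∈ V1,
    ∑ z, A x z * A z y = s * A x y + p * (if x = y then 1 else 0) + a1 * a1
  eq₁₂ : ∀ x ∈ V1, ∀ y ∈ V2, ∑ z, A x z * A z y = s * A x y + a1 * a2
  eq₂₂ : ∀ x ∈ V2, ∀ y ∈ V2,
    ∑ z, A x z * A z y = s * A x y + p * (if x = y then 1 else 0) + a2 * a2

theorem IsEquitable.sum_eq {V : Type} [Fintype V] {A : Matrix V V ℝ}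
    {V1 V2 : Finset V} {k11 k12 k21 k22 : ℝ} (h : IsEquitable A V1 V2 k11 k12 k21 k22)
    (f : V → ℝ) : ∑ z, f z = ∑ z ∈ V1, f z + ∑ z ∈ V2, f z := by
  classical
  have hV2 : V2 = V1ᶜ := by ext x; rw [h.mem_right, Finset.mem_compl]
  rw [hV2, Finset.sum_add_sum_compl]

/-- The constants of a block of a join that is neither complete nor edgeless. -/
theorem block_inequalities {V : Type} [DecidableEq V] {A : Matrix V V ℝ} {U : Finset V}
    (h01 : ∀ x y, A x y = 0 ∨ A x y = 1) (hdiag : ∀ x, A x x = 0) {k s p : ℝ} (hk : ∀ x ∈ U, ∑ z ∈ U, A x z = k)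
    (hsq : ∀ x ∈ U, ∀ y ∈ U, ∑ z ∈ U, A x z * A z y
      = s * A x y + p * (if x = y then 1 else 0) + (k - p))
    (hU : ¬ ∃ e, ∀ x ∈ U, ∀ y ∈ U, x ≠ y → A x y = e) :
    0 ≤ p ∧ p ≤ k ∧ s + 1 ≤ p ∧ 0 < k ∧ k + 1 < U.card ∧
      k * k - s * k - p = (k - p) * U.card := by
  have hnn : ∀ x y, 0 ≤ A x y := fun x y => by rcases h01 x y with h | h <;> simp [h]
  have hle : ∀ x y, A x y ≤ 1 := fun x y => by rcases h01 x y with h | h <;> simp [h]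
  have hmul : ∀ x y z, A x z * A z y ≤ A x z := fun x y z =>
    mul_le_of_le_one_right (hnn x z) (hle z y)
  obtain ⟨x, hx, y, hy, hxy, hA0⟩ : ∃ x ∈ U, ∃ y ∈ U, x ≠ y ∧ A x y = 0 := by
    by_contra! hne
    exact hU ⟨1, fun x hx y hy hxy => (h01 x y).resolve_left (hne x hx y hy hxy)⟩
  obtain ⟨x', hx', y', hy', hxy', hA1⟩ : ∃ x ∈ U, ∃ y ∈ U, x ≠ y ∧ A x y = 1 := by
    by_contra! hne
    exact hU ⟨0, fun x hx y hy hxy => (h01 x y).resolve_right (hne x hx y hy hxy)⟩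
  have e0 := hsq x hx y hy
  rw [hA0, if_neg hxy] at e0
  have e1 := hsq x' hx' y' hy'
  rw [hA1, if_neg hxy'] at e1
  have i1 : 0 ≤ ∑ z ∈ U, A x z * A z y :=
    Finset.sum_nonneg fun z _ => mul_nonneg (hnn x z) (hnn z y)
  have i2 : ∑ z ∈ U, A x z * A z y ≤ ∑ z ∈ U, A x z := Finset.sum_le_sum fun z _ => hmul x y z
  rw [hk x hx] at i2
  have i3 : ∑ z ∈ U, A x' z * A z y' ≤ ∑ z ∈ U, (A x' z - if z = y' then 1 else 0) := by
    refine Finset.sum_le_sum fun z _ => ?_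
    by_cases hz : z = y'
    · simp [hz, hdiag, hA1]
    · simpa [hz] using hmul x' y' z
  rw [Finset.sum_sub_distrib, hk x' hx', Finset.sum_ite_eq' U y', if_pos hy'] at i3
  have i4 : A x' y' ≤ ∑ z ∈ U, A x' z :=
    Finset.single_le_sum (f := fun z => A x' z) (fun z _ => hnn x' z) hy'
  rw [hk x' hx', hA1] at i4
  have i5 : ∑ z ∈ U, A x z
      ≤ ∑ z ∈ U, ((1 - if z = x then 1 else 0) - if z = y then 1 else 0) := by
    refine Finset.sum_le_sum fun z _ => ?_
    by_cases hzx : z = x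
    · simp [hzx, hdiag, hxy]
    · by_cases hzy : z = y
      · simp [hzy, hA0, hxy.symm]
      · simpa [hzx, hzy] using hle x z
  rw [Finset.sum_sub_distrib, Finset.sum_sub_distrib, Finset.sum_ite_eq' U y, if_pos hy,
    Finset.sum_ite_eq' U x, if_pos hx, hk x hx, Finset.sum_const, nsmul_eq_mul] at i5
  have e2 : ∑ w ∈ U, ∑ z ∈ U, A x z * A z w = k * k := by
    rw [Finset.sum_comm]
    simp_rw [← Finset.mul_sum]
    rw [Finset.sum_congr rfl fun z hz => by rw [hk z hz], ← Finset.sum_mul, hk x hx]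
  have e3 : ∑ w ∈ U, ∑ z ∈ U, A x z * A z w = s * k + p + U.card * (k - p) := by
    rw [Finset.sum_congr rfl fun w hw => hsq x hx w hw, Finset.sum_add_distrib,
      Finset.sum_add_distrib, ← Finset.mul_sum, ← Finset.mul_sum, hk x hx, Finset.sum_ite_eq U x,
      if_pos hx, Finset.sum_const, nsmul_eq_mul, mul_one]
  refine ⟨by linarith, by linarith, by linarith, by linarith, by linarith, by linarith⟩

/-- The arithmetic showing that the join of two strongly regular graphs of distinct total degrees
does not have exactly three eigenvalues. -/
theorem join_arithmetic {t1 t2 k1 k2 n1 n2 : ℝ} (ht : t2 < t1) (hp0 : 0 ≤ -(t1 * t2))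
    (hs : t1 + t2 + 1 ≤ -(t1 * t2)) (hpk1 : -(t1 * t2) ≤ k1) (hpk2 : -(t1 * t2) ≤ k2)
    (hk1 : 0 < k1) (hk2 : 0 < k2) (hn1 : k1 + 1 < n1) (hn2 : k2 + 1 < n2)
    (h1 : k1 * k1 - (t1 + t2) * k1 - -(t1 * t2) = (k1 - -(t1 * t2)) * n1)
    (h2 : k2 * k2 - (t1 + t2) * k2 - -(t1 * t2) = (k2 - -(t1 * t2)) * n2)
    (h12 : (k1 + k2 - (t1 + t2)) ^ 2 = (k1 + n2 - -(t1 * t2)) * (k2 + n1 - -(t1 * t2))) :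
    k1 + n2 = n1 + k2 := by
  have ht2 : t2 ≤ -1 := by
    by_contra! hlt
    nlinarith
  have ht1 : 0 ≤ t1 := by
    by_contra! hlt
    nlinarith
  have hpt : t1 ≤ -(t1 * t2) := by nlinarith
  have hf1 : n1 * n2 ≠ (k1 - t1) * (k2 - t1) := by
    have : (k1 - t1) * (k2 - t1) ≤ k1 * k2 :=
      mul_le_mul (by linarith) (by linarith) (by linarith) hk1.le
    have : k1 * k2 < n1 * n2 := mul_lt_mul'' (by linarith) (by linarith) hk1.le hk2.le
    linarith
  have hsum : n1 * n2 + (k1 - -(t1 * t2)) * (k2 - -(t1 * t2))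
      = (k1 - t1) * (k2 - t1) + (k1 - t2) * (k2 - t2) := by linarith
  have hprod : (n1 * n2) * ((k1 - -(t1 * t2)) * (k2 - -(t1 * t2)))
      = ((k1 - t1) * (k2 - t1)) * ((k1 - t2) * (k2 - t2)) := by
    calc _ = ((k1 - -(t1 * t2)) * n1) * ((k2 - -(t1 * t2)) * n2) := by ring
      _ = _ := by rw [← h1, ← h2]; ring
  have hX : n1 * n2 = (k1 - t2) * (k2 - t2) := by
    have h0 : (n1 * n2 - (k1 - t1) * (k2 - t1)) * (n1 * n2 - (k1 - t2) * (k2 - t2)) = 0 := by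
      linear_combination (n1 * n2) * hsum - hprod
    rcases mul_eq_zero.1 h0 with h | h
    · exact absurd (sub_eq_zero.1 h) hf1
    · exact sub_eq_zero.1 h
  have hp : t1 = -(t1 * t2) := by
    by_contra hne
    have hlt := lt_of_le_of_ne hpt hne
    have : (k1 - -(t1 * t2)) * (k2 - -(t1 * t2)) < (k1 - t1) * (k2 - t1) :=
      mul_lt_mul'' (by linarith) (by linarith) (by linarith) (by linarith)
    linarith
  have h0 : t1 * (1 + t2) = 0 := by linarith
  rcases mul_eq_zero.1 h0 with h | h
  · subst h
    have e1 : n1 = k1 - t2 := mul_left_cancel₀ hk1.ne' (by linarith)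
    have e2 : n2 = k2 - t2 := mul_left_cancel₀ hk2.ne' (by linarith)
    linarith
  · have : t2 = -1 := by linarith
    subst this
    have : (k1 - -1) * (k2 - -1) < n1 * n2 :=
      mul_lt_mul'' (by linarith) (by linarith) (by linarith) (by linarith)
    linarith

namespace IsBiregular

variable {V : Type} [Fintype V] [DecidableEq V] {A : Matrix V V ℝ} {V1 V2 : Finset V}
  {k11 k12 k21 k22 s p a1 a2 : ℝ}

theorem symm (h : IsBiregular A V1 V2 k11 k12 k21 k22 s p a1 a2) :
    IsBiregular A V2 V1 k22 k21 k12 k11 s p a2 a1 :=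
  ⟨h.toIsEquitable.symm, h.apply_comm, h.zero_or_one, h.apply_self, h.pos_right, h.pos_left,
    h.eq₂₂, fun x hx y hy => by
      rw [h.apply_comm x y, mul_comm a2 a1, ← h.eq₁₂ y hy x hx]
      exact Finset.sum_congr rfl fun z _ => by
        rw [h.apply_comm x z, h.apply_comm z y, mul_comm], h.eq₁₁⟩

theorem mul_apply_self (h : IsBiregular A V1 V2 k11 k12 k21 k22 s p a1 a2) (x y : V) :
    A x y * A y x = A x y := by
  rw [h.apply_comm y x]
  rcases h.zero_or_one x y with h | h <;> simp [h]

theorem sq_left (h : IsBiregular A V1 V2 k11 k12 k21 k22 s p a1 a2) :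
    a1 * a1 = k11 + k12 - p := by
  obtain ⟨x, hx⟩ := h.nonempty_left
  have h1 := h.eq₁₁ x hx x hx
  rw [Finset.sum_congr rfl fun z _ => h.mul_apply_self x z, h.sum_eq, h.sum₁₁ x hx, h.sum₁₂ x hx,
    h.apply_self, if_pos rfl] at h1
  linarith

theorem sq_right (h : IsBiregular A V1 V2 k11 k12 k21 k22 s p a1 a2) :
    a2 * a2 = k21 + k22 - p := by
  rw [h.symm.sq_left, add_comm]

section Join

variable (h : IsBiregular A V1 V2 k11 k12 k21 k22 s p a1 a2)
  (hcross : ∀ x ∈ V1, ∀ y ∈ V2, A x y = 1)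

include h hcross

theorem eq_card_of_join : k12 = V2.card := by
  obtain ⟨x, hx⟩ := h.nonempty_left
  rw [← h.sum₁₂ x hx, Finset.sum_congr rfl (hcross x hx)]
  simp

theorem sum_mul_of_join {x y : V} (hx : x ∈ V1) (hy : y ∈ V1) :
    ∑ z ∈ V1, A x z * A z y = s * A x y + p * (if x = y then 1 else 0) + (k11 - p) := by
  have h1 := h.eq₁₁ x hx y hy
  have h2 : ∑ z ∈ V2, A x z * A z y = V2.card := by
    rw [Finset.sum_congr rfl fun z hz => by
      rw [hcross x hx z hz, h.apply_comm z y, hcross y hy z hz]]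
    simp
  rw [h.sum_eq, h2, h.sq_left, h.eq_card_of_join hcross] at h1
  linarith

theorem mul_eq_of_join : a1 * a2 = k11 + k22 - s := by
  obtain ⟨x, hx⟩ := h.nonempty_left
  obtain ⟨y, hy⟩ := h.nonempty_right
  have h1 := h.eq₁₂ x hx y hy
  rw [h.sum_eq, Finset.sum_congr rfl fun z hz => by rw [hcross z hz y hy, mul_one], h.sum₁₁ x hx,
    Finset.sum_congr (s₁ := V2) rfl fun z hz => by rw [hcross x hx z hz, one_mul, h.apply_comm],
    h.sum₂₂ y hy, hcross x hx y hy] at h1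
  linarith

/-- If a biregular graph is a join, the two factors are not both nontrivial. -/
theorem exists_const_of_join {t1 t2 : ℝ} (ht : t2 < t1) (hs : s = t1 + t2) (hp : p = -(t1 * t2))
    (hne : k11 + k12 ≠ k21 + k22) :
    (∃ e, ∀ x ∈ V1, ∀ y ∈ V1, x ≠ y → A x y = e) ∨
      ∃ e, ∀ x ∈ V2, ∀ y ∈ V2, x ≠ y → A x y = e := by
  by_contra! hcon
  obtain ⟨hU1, hU2⟩ := hcon
  have hcross' : ∀ x ∈ V2, ∀ y ∈ V1, A x y = 1 := fun x hx y hy => by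
    rw [h.apply_comm, hcross y hy x hx]
  obtain ⟨hp0, hpk1, hsp, hk1, hn1, e1⟩ := block_inequalities h.zero_or_one
    h.apply_self h.sum₁₁ (fun x hx y hy => h.sum_mul_of_join hcross hx hy) (by push Not; exact hU1)
  obtain ⟨-, hpk2, -, hk2, hn2, e2⟩ := block_inequalities h.zero_or_one
    h.apply_self h.sum₂₂ (fun x hx y hy => h.symm.sum_mul_of_join hcross' hx hy)
    (by push Not; exact hU2)
  have h12 : (k11 + k22 - s) ^ 2 = (k11 + V2.card - p) * (k22 + V1.card - p) := by
    rw [← h.mul_eq_of_join hcross, ← h.eq_card_of_join hcross, ← h.symm.eq_card_of_join hcross',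
      ← h.sq_left, add_comm k22, ← h.sq_right]
    ring
  subst hs hp
  refine hne ?_
  rw [h.eq_card_of_join hcross, h.symm.eq_card_of_join hcross']
  exact join_arithmetic ht hp0 hsp hpk1 hpk2 hk1 hk2 hn1 hn2 e1 e2 h12

end Join

section Split

variable (h : IsBiregular A V1 V2 k11 k12 k21 k22 s p a1 a2) {e1 e2 : ℝ}

include h

theorem row_left_of_split (he : ∀ x ∈ V1, ∀ y ∈ V1, x ≠ y → A x y = e1) {x : V} (hx : x ∈ V1)
    (z : V) (hz : z ∈ V1) : A x z = e1 - e1 * if x = z then 1 else 0 := by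
  by_cases hxz : x = z
  · simp [← hxz, h.apply_self]
  · simp [hxz, he x hx z hz hxz]

theorem left_eq_of_split (he : ∀ x ∈ V1, ∀ y ∈ V1, x ≠ y → A x y = e1) :
    k11 = e1 * (V1.card - 1) := by
  obtain ⟨x, hx⟩ := h.nonempty_left
  rw [← h.sum₁₁ x hx, Finset.sum_congr rfl (h.row_left_of_split he hx), Finset.sum_sub_distrib,
    ← Finset.mul_sum, Finset.sum_ite_eq V1 x, if_pos hx, Finset.sum_const, nsmul_eq_mul]
  ring

theorem sum_left_mul_of_split (he : ∀ x ∈ V1, ∀ y ∈ V1, x ≠ y → A x y = e1) {x y : V}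
    (hx : x ∈ V1) : ∑ z ∈ V1, A x z * A z y = e1 * (∑ z ∈ V1, A z y - A x y) := by
  rw [Finset.sum_congr rfl fun z hz => by rw [h.row_left_of_split he hx z hz, sub_mul, mul_assoc],
    Finset.sum_sub_distrib, ← Finset.mul_sum, ← Finset.mul_sum]
  simp [hx, mul_sub]

theorem cross_eq_of_split (he₁ : ∀ x ∈ V1, ∀ y ∈ V1, x ≠ y → A x y = e1)
    (he₂ : ∀ x ∈ V2, ∀ y ∈ V2, x ≠ y → A x y = e2) {x y : V} (hx : x ∈ V1) (hy : y ∈ V2) :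
    e1 * k21 + e2 * k12 - (e1 + e2) * A x y = s * A x y + a1 * a2 := by
  have h1 := h.eq₁₂ x hx y hy
  have h2 : ∑ z ∈ V2, A x z * A z y = ∑ z ∈ V2, A y z * A z x :=
    Finset.sum_congr rfl fun z _ => by rw [h.apply_comm x z, h.apply_comm z y, mul_comm]
  have h3 : ∑ z ∈ V1, A z y = k21 := by
    rw [← h.sum₂₁ y hy]
    exact Finset.sum_congr rfl fun z _ => h.apply_comm z y
  have h4 : ∑ z ∈ V2, A z x = k12 := by
    rw [← h.sum₁₂ x hx]
    exact Finset.sum_congr rfl fun z _ => h.apply_comm z x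
  rw [h.sum_eq, h2, h.sum_left_mul_of_split he₁ hx, h.symm.sum_left_mul_of_split he₂ hy, h3, h4,
    h.apply_comm y x] at h1
  linarith

theorem gram_of_split (he₁ : ∀ x ∈ V1, ∀ y ∈ V1, x ≠ y → A x y = e1) (h01 : e1 = 0 ∨ e1 = 1)
    (hs : s = -(e1 + e2)) {x y : V} (hx : x ∈ V1) (hy : y ∈ V1) (hxy : x ≠ y) :
    ∑ z ∈ V2, A x z * A z y = k12 - (p + e1 * e2) := by
  have h1 := h.eq₁₁ x hx y hy
  have h3 : ∑ z ∈ V1, A z y = k11 := by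
    rw [← h.sum₁₁ y hy]
    exact Finset.sum_congr rfl fun z _ => h.apply_comm z y
  rw [h.sum_eq, h.sum_left_mul_of_split he₁ hx, h3, he₁ x hx y hy hxy, if_neg hxy, h.sq_left,
    hs] at h1
  have h4 := h.left_eq_of_split he₁
  rcases h01 with h0 | h0 <;> subst h0 <;> linarith

theorem mul_eq_of_split (he₁ : ∀ x ∈ V1, ∀ y ∈ V1, x ≠ y → A x y = e1) (h01 : e1 = 0 ∨ e1 = 1)
    (hs : s = -(e1 + e2)) :
    k12 * k21 = k12 + (V1.card - 1) * (k12 - (p + e1 * e2)) := by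
  obtain ⟨x, hx⟩ := h.nonempty_left
  have h1 : ∑ y ∈ V1, ∑ z ∈ V2, A x z * A z y = k12 * k21 := by
    rw [Finset.sum_comm]
    simp_rw [← Finset.mul_sum]
    rw [Finset.sum_congr rfl fun z hz => by rw [h.sum₂₁ z hz], ← Finset.sum_mul, h.sum₁₂ x hx]
  have h2 : ∀ y ∈ V1, ∑ z ∈ V2, A x z * A z y
      = (k12 - (p + e1 * e2)) + (p + e1 * e2) * if x = y then 1 else 0 := by
    intro y hy
    by_cases hxy : x = y
    · subst hxy
      simp [h.mul_apply_self, h.sum₁₂ x hx]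
    · simp [hxy, h.gram_of_split he₁ h01 hs hx hy hxy]
  rw [← h1, Finset.sum_congr rfl h2, Finset.sum_add_distrib, ← Finset.mul_sum,
    Finset.sum_ite_eq V1 x, if_pos hx, Finset.sum_const, nsmul_eq_mul]
  ring

theorem apply_eq_of_gram {x y : V} (hx : x ∈ V1) (hy : y ∈ V1)
    (hxy : x ≠ y → ∑ z ∈ V2, A x z * A z y = k12) {z : V} (hz : z ∈ V2) : A x z = A y z := by
  by_cases hne : x = y
  · rw [hne]
  have h0 : ∑ z ∈ V2, (A x z - A y z) ^ 2 = 0 := by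
    have h1 : ∀ z, (A x z - A y z) ^ 2 = A x z + A y z - 2 * (A x z * A z y) := by
      intro z
      have h2 := h.mul_apply_self x z
      have h3 := h.mul_apply_self y z
      rw [h.apply_comm z x] at h2
      rw [h.apply_comm z y] at h3 ⊢
      linear_combination h2 + h3
    simp_rw [h1]
    rw [Finset.sum_sub_distrib, Finset.sum_add_distrib, ← Finset.mul_sum, hxy hne, h.sum₁₂ x hx,
      h.sum₁₂ y hy]
    ring
  have h1 := (Finset.sum_eq_zero_iff_of_nonneg fun z _ => sq_nonneg _).1 h0 z hz
  exact sub_eq_zero.1 (pow_eq_zero_iff two_ne_zero |>.1 h1)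

theorem sum_comm_cross : V1.card * k12 = V2.card * k21 := by
  have h1 : ∑ x ∈ V1, ∑ y ∈ V2, A x y = ∑ y ∈ V2, ∑ x ∈ V1, A y x :=
    Finset.sum_comm.trans <|
      Finset.sum_congr rfl fun y _ => Finset.sum_congr rfl fun x _ => h.apply_comm x y
  rwa [Finset.sum_congr rfl h.sum₁₂, Finset.sum_congr rfl h.sum₂₁, Finset.sum_const,
    Finset.sum_const, nsmul_eq_mul, nsmul_eq_mul] at h1

theorem symmetric_of_split (he₁ : ∀ x ∈ V1, ∀ y ∈ V1, x ≠ y → A x y = e1)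
    (he₂ : ∀ x ∈ V2, ∀ y ∈ V2, x ≠ y → A x y = e2) (h01₁ : e1 = 0 ∨ e1 = 1)
    (h01₂ : e2 = 0 ∨ e2 = 1)
    (hM : ¬ ∀ x ∈ V1, ∀ y ∈ V2, ∀ x' ∈ V1, ∀ y' ∈ V2, A x y = A x' y') :
    s = -(e1 + e2) ∧ V1.card = V2.card ∧ k12 = k21 := by
  have hs : s = -(e1 + e2) := by
    push Not at hM
    obtain ⟨x, hx, y, hy, x', hx', y', hy', hne⟩ := hM
    have h1 := h.cross_eq_of_split he₁ he₂ hx hy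
    have h2 := h.cross_eq_of_split he₁ he₂ hx' hy'
    have h3 : (s + (e1 + e2)) * (A x y - A x' y') = 0 := by linarith
    rcases mul_eq_zero.1 h3 with h3 | h3
    · linarith
    · exact absurd (sub_eq_zero.1 h3) hne
  have hs' : s = -(e2 + e1) := by rw [hs, add_comm]
  have hc : p + e1 * e2 ≠ 0 := by
    intro hc
    refine hM fun x hx y hy x' hx' y' hy' => ?_
    have h1 : A x y = A x' y := h.apply_eq_of_gram hx hx'
      (fun hne => by rw [h.gram_of_split he₁ h01₁ hs hx hx' hne, hc, sub_zero]) hy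
    have h2 : A y x' = A y' x' := h.symm.apply_eq_of_gram hy hy'
      (fun hne => by
        rw [h.symm.gram_of_split he₂ h01₂ hs' hy hy' hne, mul_comm e2, hc, sub_zero]) hx'
    rw [h1, h.apply_comm, h2, h.apply_comm]
  have h1 := h.mul_eq_of_split he₁ h01₁ hs
  have h2 := h.symm.mul_eq_of_split he₂ h01₂ hs'
  have h3 := h.sum_comm_cross
  have h4 : (p + e1 * e2) * (V1.card - V2.card : ℝ) = 0 := by linarith
  have h5 : (V1.card : ℝ) = V2.card :=
    sub_eq_zero.1 ((mul_eq_zero.1 h4).resolve_left hc)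
  refine ⟨hs, by exact_mod_cast h5, ?_⟩
  rw [h5] at h3
  exact mul_left_cancel₀ (by simpa using h.nonempty_right.ne_empty) h3

theorem sq_parameters_of_split (he₁ : ∀ x ∈ V1, ∀ y ∈ V1, x ≠ y → A x y = 0)
    (he₂ : ∀ x ∈ V2, ∀ y ∈ V2, x ≠ y → A x y = 1)
    (hM : ¬ ∀ x ∈ V1, ∀ y ∈ V2, ∀ x' ∈ V1, ∀ y' ∈ V2, A x y = A x' y') :
    ∃ l : ℕ, 0 < l ∧ (V1.card : ℝ) = l ^ 3 - l + 1 ∧ (V2.card : ℝ) = l ^ 3 - l + 1 ∧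
      k12 = (l : ℝ) ^ 2 ∧ k21 = (l : ℝ) ^ 2 ∧
      ∀ x ∈ V1, ∀ y ∈ V1, x ≠ y → ∑ z ∈ V2, A x z * A z y = l := by
  obtain ⟨hs, hn, hr⟩ := h.symmetric_of_split he₁ he₂ (.inl rfl) (.inr rfl) hM
  have hk11 := h.left_eq_of_split he₁
  have hk22 := h.symm.left_eq_of_split he₂
  have hgram : ∀ x ∈ V1, ∀ y ∈ V1, x ≠ y → ∑ z ∈ V2, A x z * A z y = a1 * a1 := by
    intro x hx y hy hxy
    rw [h.gram_of_split he₁ (.inl rfl) hs hx hy hxy, h.sq_left, hk11]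
    ring
  have hmul := h.mul_eq_of_split he₁ (.inl rfl) hs
  have ha1 := h.sq_left
  have ha2 := h.sq_right
  have ha12 : a1 * a2 = k12 := by
    obtain ⟨x, hx⟩ := h.nonempty_left
    obtain ⟨y, hy⟩ := h.nonempty_right
    have := h.cross_eq_of_split he₁ he₂ hx hy
    rw [hs] at this
    linarith
  rw [← hn] at hk22
  subst hk11 hk22
  have hpos : 0 < a1 * a1 := mul_pos h.pos_left h.pos_left
  have hr2 : k12 = (a1 * a1) ^ 2 := by
    have e1 : k12 * k12 = (a1 * a1) * (a2 * a2) := by rw [← ha12]; ring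
    have e2 : a2 * a2 = a1 * a1 + (V1.card - 1) := by linarith
    rw [← hr, zero_mul, add_zero] at hmul
    rw [e2] at e1
    have e3 : k12 - p = a1 * a1 := by linarith
    rw [e3] at hmul
    linarith
  have hcard : (V1.card : ℝ) = (a1 * a1) ^ 3 - a1 * a1 + 1 := by
    have e3 : k12 - (p + 0 * 1) = a1 * a1 := by linarith
    rw [← hr, e3, hr2] at hmul
    have : (a1 * a1) * ((V1.card : ℝ) - 1) = (a1 * a1) * ((a1 * a1) ^ 3 - a1 * a1) := by
      linarith
    linarith [mul_left_cancel₀ hpos.ne' this]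
  obtain ⟨l, hl⟩ : ∃ l : ℕ, (l : ℝ) = a1 * a1 := by
    by_cases h1 : V1.card ≤ 1
    · refine ⟨1, ?_⟩
      have h2 : V1.card = 1 := le_antisymm h1 h.nonempty_left.card_pos
      rw [h2] at hcard
      have h3 : (a1 * a1) * ((a1 * a1 - 1) * (a1 * a1 + 1)) = 0 := by
        push_cast at hcard
        linarith
      have h4 := (mul_eq_zero.1 ((mul_eq_zero.1 h3).resolve_left hpos.ne')).resolve_right
        (by linarith)
      push_cast
      linarith
    · obtain ⟨x, hx, y, hy, hxy⟩ := Finset.one_lt_card.1 (not_le.1 h1)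
      have hnat : ∀ z, ∃ m : ℕ, (m : ℝ) = A x z * A z y := by
        intro z
        rcases h.zero_or_one x z with h1 | h1 <;> rcases h.zero_or_one z y with h2 | h2
        exacts [⟨0, by simp [h1]⟩, ⟨0, by simp [h1]⟩, ⟨0, by simp [h2]⟩, ⟨1, by simp [h1, h2]⟩]
      choose m hm using hnat
      refine ⟨∑ z ∈ V2, m z, ?_⟩
      rw [← hgram x hx y hy hxy, Nat.cast_sum]
      exact Finset.sum_congr rfl fun z _ => hm z
  rw [← hl] at hcard hr2 hgram hpos
  exact ⟨l, by exact_mod_cast hpos, hcard, hn ▸ hcard, hr2, hr ▸ hr2, hgram⟩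

end Split

end IsBiregular

theorem IsEquitable.sum_row {V : Type} [Fintype V] {A : Matrix V V ℝ}
    {V1 V2 : Finset V} {k11 k12 k21 k22 : ℝ} (h : IsEquitable A V1 V2 k11 k12 k21 k22) {x : V}
    (hx : x ∈ V1) : ∑ z, A x z = k11 + k12 := by
  rw [h.sum_eq, h.sum₁₁ x hx, h.sum₁₂ x hx]

namespace SimpleGraph

variable {V : Type} [Fintype V] [DecidableEq V] {G : SimpleGraph V} [DecidableRel G.Adj]

omit [Fintype V] [DecidableEq V] in
theorem adjMatrix_zero_or_one (x y : V) : G.adjMatrix ℝ x y = 0 ∨ G.adjMatrix ℝ x y = 1 := by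
  by_cases h : G.Adj x y <;> simp [h]

omit [DecidableEq V] in
theorem adjMatrix_mul_apply_self (x : V) :
    (G.adjMatrix ℝ * G.adjMatrix ℝ) x x = ∑ z, G.adjMatrix ℝ x z := by
  rw [Matrix.mul_apply]
  refine Finset.sum_congr rfl fun z _ => ?_
  by_cases h : G.Adj x z <;> simp [h, G.adj_comm z x]

theorem exists_isCoherentConfig_of_regular {θ0 θ1 θ2 : ℝ} (h : InG3 G θ0 θ1 θ2)
    (hreg : ∀ x y, ∑ z, G.adjMatrix ℝ x z = ∑ z, G.adjMatrix ℝ y z) :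
    ∃ W : Fin 3 → Matrix V V ℝ,
      IsCoherentConfig W ∧ G.adjMatrix ℝ ∈ Submodule.span ℝ (Set.range W) := by
  obtain ⟨α, hα, hA⟩ := exists_perron h
  obtain ⟨x0⟩ := h.1.nonempty
  have hsq : ∀ x, α x * α x = ∑ z, G.adjMatrix ℝ x z + θ1 * θ2 := by
    intro x
    have h1 := congrFun (congrFun hA x) x
    rw [adjMatrix_mul_apply_self] at h1
    simp [Matrix.vecMulVec_apply] at h1 ⊢
    linarith
  have hconst : ∀ x, α x = α x0 := by
    intro x
    have h1 : α x * α x = α x0 * α x0 := by rw [hsq, hsq, hreg x x0]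
    nlinarith [hα x, hα x0]
  refine ⟨_, isCoherentConfig_of_regular adjMatrix_zero_or_one (transpose_adjMatrix G)
    (fun x => by simp) (fun x => hreg x x0)
    (s := θ1 + θ2) (p := -(θ1 * θ2)) (q := α x0 * α x0) ?_, Submodule.subset_span ⟨1, rfl⟩⟩
  rw [hA]
  ext x y
  simp [Matrix.vecMulVec_apply, hconst x, hconst y, sub_eq_add_neg]

theorem exists_isBiregular {θ0 θ1 θ2 : ℝ} (h : InG3 G θ0 θ1 θ2) {V1 V2 : Finset V}
    {k11 k12 k21 k22 : ℝ} (hE : IsEquitable (G.adjMatrix ℝ) V1 V2 k11 k12 k21 k22) :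
    ∃ a1 a2, IsBiregular (G.adjMatrix ℝ) V1 V2 k11 k12 k21 k22 (θ1 + θ2) (-(θ1 * θ2)) a1 a2 := by
  obtain ⟨α, hα, hA⟩ := exists_perron h
  have hK : ∀ x y, ∑ z, G.adjMatrix ℝ x z * G.adjMatrix ℝ z y
      = (θ1 + θ2) * G.adjMatrix ℝ x y + -(θ1 * θ2) * (if x = y then 1 else 0) + α x * α y := by
    intro x y
    rw [← Matrix.mul_apply, hA]
    simp only [Matrix.add_apply, Matrix.sub_apply, Matrix.smul_apply, smul_eq_mul,
      Matrix.one_apply, Matrix.vecMulVec_apply]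
    ring
  have hsq : ∀ x, α x * α x = ∑ z, G.adjMatrix ℝ x z + θ1 * θ2 := by
    intro x
    have h1 := hK x x
    rw [← Matrix.mul_apply, adjMatrix_mul_apply_self, if_pos rfl, adjMatrix_apply,
      if_neg (G.irrefl)] at h1
    linarith
  have heq : ∀ x y, ∑ z, G.adjMatrix ℝ x z = ∑ z, G.adjMatrix ℝ y z → α x = α y := by
    intro x y hxy
    have h1 : α x * α x = α y * α y := by rw [hsq, hsq, hxy]
    nlinarith [hα x, hα y]
  obtain ⟨x1, hx1⟩ := hE.nonempty_left
  obtain ⟨x2, hx2⟩ := hE.nonempty_right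
  have hα1 : ∀ x ∈ V1, α x = α x1 := fun x hx =>
    heq x x1 (by rw [hE.sum_row hx, hE.sum_row hx1])
  have hα2 : ∀ x ∈ V2, α x = α x2 := fun x hx =>
    heq x x2 (by rw [hE.symm.sum_row hx, hE.symm.sum_row hx2])
  refine ⟨α x1, α x2, hE, fun x y => by simp [G.adj_comm x y], adjMatrix_zero_or_one,
    fun x => by simp, hα x1, hα x2, fun x hx y hy => ?_, fun x hx y hy => ?_,
    fun x hx y hy => ?_⟩
  · rw [hK, hα1 x hx, hα1 y hy]
  · rw [hK, hα1 x hx, hα2 y hy, if_neg fun hxy : x = y => (hE.mem_right y).1 hy (hxy ▸ hx)]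
    ring
  · rw [hK, hα2 x hx, hα2 y hy]

end SimpleGraph

namespace IsBiregular

variable {V : Type} [Fintype V] [DecidableEq V] {A : Matrix V V ℝ} {V1 V2 : Finset V}
  {k11 k12 k21 k22 s p a1 a2 : ℝ}

/-- A biregular graph in which the adjacency between the two parts is constant is a join. -/
theorem cross_eq_one (h : IsBiregular A V1 V2 k11 k12 k21 k22 s p a1 a2)
    (hM : ∀ x ∈ V1, ∀ y ∈ V2, ∀ x' ∈ V1, ∀ y' ∈ V2, A x y = A x' y') :
    ∀ x ∈ V1, ∀ y ∈ V2, A x y = 1 := by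
  intro x hx y hy
  refine (h.zero_or_one x y).resolve_left fun h0 => ?_
  have h1 := h.eq₁₂ x hx y hy
  rw [h.sum_eq, Finset.sum_eq_zero fun z hz => by rw [hM z hz y hy x hx y hy, h0, mul_zero],
    Finset.sum_eq_zero fun z hz => by rw [hM x hx z hz x hx y hy, h0, zero_mul], h0] at h1
  have := mul_pos h.pos_left h.pos_right
  linarith

theorem exists_isCoherentConfig_of_join (h : IsBiregular A V1 V2 k11 k12 k21 k22 s p a1 a2)
    {t1 t2 : ℝ} (ht : t2 < t1) (hs : s = t1 + t2) (hp : p = -(t1 * t2))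
    (hne : k11 + k12 ≠ k21 + k22) (hcross : ∀ x ∈ V1, ∀ y ∈ V2, A x y = 1) :
    ∃ W : Fin 7 → Matrix V V ℝ, IsCoherentConfig W ∧ A ∈ Submodule.span ℝ (Set.range W) := by
  have hcross' : ∀ x ∈ V2, ∀ y ∈ V1, A x y = 1 := fun x hx y hy => by
    rw [h.apply_comm, hcross y hy x hx]
  rcases h.exists_const_of_join hcross ht hs hp hne with ⟨e, he⟩ | ⟨e, he⟩
  · exact _root_.exists_isCoherentConfig_of_join h.toIsEquitable h.apply_comm h.zero_or_one
      h.apply_self hcross he fun x hx y hy => h.symm.sum_mul_of_join hcross' hx hy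
  · exact _root_.exists_isCoherentConfig_of_join h.toIsEquitable.symm h.apply_comm h.zero_or_one
      h.apply_self hcross' he fun x hx y hy => h.sum_mul_of_join hcross hx hy

end IsBiregular

namespace SimpleGraph

variable {V : Type} [Fintype V] [DecidableEq V] {G : SimpleGraph V} [DecidableRel G.Adj]

theorem exists_design_of_split {V1 V2 : Finset V} {k11 k12 k21 k22 s p a1 a2 : ℝ}
    (h : IsBiregular (G.adjMatrix ℝ) V1 V2 k11 k12 k21 k22 s p a1 a2)
    (he₁ : ∀ x ∈ V1, ∀ y ∈ V1, x ≠ y → G.adjMatrix ℝ x y = 0)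
    (he₂ : ∀ x ∈ V2, ∀ y ∈ V2, x ≠ y → G.adjMatrix ℝ x y = 1)
    (hM : ¬ ∀ x ∈ V1, ∀ y ∈ V2, ∀ x' ∈ V1, ∀ y' ∈ V2,
      G.adjMatrix ℝ x y = G.adjMatrix ℝ x' y') :
    ∃ l : ℕ, 0 < l ∧ ∃ V1 V2 : Finset V,
      Disjoint V1 V2 ∧ V1 ∪ V2 = Finset.univ ∧
      V1.card = l ^ 3 - l + 1 ∧ V2.card = l ^ 3 - l + 1 ∧
      (∀ x ∈ V1, ∀ y ∈ V1, ¬ G.Adj x y) ∧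
      (∀ x ∈ V2, ∀ y ∈ V2, x ≠ y → G.Adj x y) ∧
      ∃ M : Matrix {x // x ∈ V1} {x // x ∈ V2} ℝ,
        M = Matrix.of (fun x y => if G.Adj x.1 y.1 then 1 else 0) ∧
        (∀ x, ∑ y, M x y = (l : ℝ) ^ 2) ∧
        (∀ y, ∑ x, M x y = (l : ℝ) ^ 2) ∧
        M * Mᵀ = ((l : ℝ) ^ 2 - l) • (1 : Matrix {x // x ∈ V1} {x // x ∈ V1} ℝ)
          + (l : ℝ) • Matrix.of (fun _ _ => 1) := by
  obtain ⟨l, hl, hn1, hn2, hr1, hr2, hgram⟩ := h.sq_parameters_of_split he₁ he₂ hM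
  have hcard : ∀ n : ℕ, (n : ℝ) = l ^ 3 - l + 1 → n = l ^ 3 - l + 1 := by
    intro n hn
    have hle : l ≤ l ^ 3 := Nat.le_self_pow three_ne_zero l
    have : (n : ℝ) = ((l ^ 3 - l + 1 : ℕ) : ℝ) := by
      rw [hn]
      push_cast [Nat.cast_sub hle]
      ring
    exact_mod_cast this
  have hrow : ∀ x ∈ V1, ∑ z ∈ V2, G.adjMatrix ℝ x z = (l : ℝ) ^ 2 := fun x hx =>
    (h.sum₁₂ x hx).trans hr1
  refine ⟨l, hl, V1, V2, ?_, ?_, hcard _ hn1, hcard _ hn2, fun x hx y hy hxy => ?_,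
    fun x hx y hy hxy => ?_, _, rfl, fun x => ?_, fun y => ?_, ?_⟩
  · exact Finset.disjoint_left.2 fun x hx1 hx2 => (h.mem_right x).1 hx2 hx1
  · ext x
    simpa [h.mem_right] using em (x ∈ V1)
  · have := he₁ x hx y hy hxy.ne
    simp [hxy] at this
  · by_contra hn
    have := he₂ x hx y hy hxy
    simp [hn] at this
  · rw [← hrow x.1 x.2, ← Finset.sum_coe_sort V2]
    rfl
  · rw [← hr2, ← h.sum₂₁ y.1 y.2, ← Finset.sum_coe_sort V1]
    exact Finset.sum_congr rfl fun x _ => h.apply_comm x.1 y.1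
  · ext x y
    have h1 : ∑ z ∈ V2, G.adjMatrix ℝ x.1 z * G.adjMatrix ℝ z y.1
        = ((l : ℝ) ^ 2 - l) * (if x = y then 1 else 0) + l := by
      by_cases hxy : x = y
      · subst hxy
        simp_rw [h.mul_apply_self]
        simp [-adjMatrix_apply, hrow x.1 x.2]
      · rw [hgram x.1 x.2 y.1 y.2 (Subtype.coe_injective.ne hxy), if_neg hxy]
        ring
    rw [← Finset.sum_coe_sort V2] at h1
    simp only [Matrix.add_apply, Matrix.smul_apply, Matrix.one_apply, Matrix.of_apply,
      smul_eq_mul, mul_one]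
    rw [← h1, Matrix.mul_apply]
    exact Finset.sum_congr rfl fun z _ => by rw [h.apply_comm z.1 y.1]; rfl

end SimpleGraph

/-- A graph in `𝒢₃` with coherent rank `8` comes from a symmetric
`2-(λ³-λ+1, λ², λ)` design: its vertices split into an independent set `V1` and a clique
`V2`, both of size `λ³-λ+1`, whose biadjacency matrix is the incidence matrix of such a
design. -/
theorem stmt5 {V : Type} [Fintype V] [DecidableEq V] (G : SimpleGraph V) [DecidableRel G.Adj]
    (θ0 θ1 θ2 : ℝ) (h : InG3 G θ0 θ1 θ2) (h8 : HasCoherentRank G 8) :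
    ∃ l : ℕ, 0 < l ∧ ∃ V1 V2 : Finset V,
      Disjoint V1 V2 ∧ V1 ∪ V2 = Finset.univ ∧
      V1.card = l ^ 3 - l + 1 ∧ V2.card = l ^ 3 - l + 1 ∧
      (∀ x ∈ V1, ∀ y ∈ V1, ¬ G.Adj x y) ∧
      (∀ x ∈ V2, ∀ y ∈ V2, x ≠ y → G.Adj x y) ∧
      ∃ M : Matrix {x // x ∈ V1} {x // x ∈ V2} ℝ,
        M = Matrix.of (fun x y => if G.Adj x.1 y.1 then 1 else 0) ∧
        (∀ x, ∑ y, M x y = (l : ℝ) ^ 2) ∧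
        (∀ y, ∑ x, M x y = (l : ℝ) ^ 2) ∧
        M * Mᵀ = ((l : ℝ) ^ 2 - l) • (1 : Matrix {x // x ∈ V1} {x // x ∈ V1} ℝ)
          + (l : ℝ) • Matrix.of (fun _ _ => 1) := by

  obtain ⟨⟨W, hW, hA⟩, hmin⟩ := h8
  have hreg : ¬ ∀ x y, ∑ z, G.adjMatrix ℝ x z = ∑ z, G.adjMatrix ℝ y z := fun hreg =>
    absurd (hmin (SimpleGraph.exists_isCoherentConfig_of_regular h hreg)) (by norm_num)
  push Not at hreg
  obtain ⟨x0, y0, hxy⟩ := hreg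
  obtain ⟨V1, V2, k11, k12, k21, k22, hE, hcase⟩ := hW.exists_isEquitable hA
    (fun x y => by simp [G.adj_comm x y]) SimpleGraph.adjMatrix_zero_or_one hxy
  obtain ⟨a1, a2, hB⟩ := SimpleGraph.exists_isBiregular h hE
  have hne : k11 + k12 ≠ k22 + k21 := by
    intro heq
    have hdeg : ∀ x, ∑ z, G.adjMatrix ℝ x z = k11 + k12 := by
      intro x
      by_cases hx : x ∈ V1
      · exact hE.sum_row hx
      · rw [heq, hE.symm.sum_row ((hE.mem_right x).2 hx)]
    exact hxy (by rw [hdeg, hdeg])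
  have hM : ¬ ∀ x ∈ V1, ∀ y ∈ V2, ∀ x' ∈ V1, ∀ y' ∈ V2,
      G.adjMatrix ℝ x y = G.adjMatrix ℝ x' y' := fun hM =>
    absurd (hmin (hB.exists_isCoherentConfig_of_join h.2.2.1 rfl rfl (by rwa [add_comm k21])
      (hB.cross_eq_one hM))) (by norm_num)
  obtain ⟨e1, e2, h1, h2, he₁, he₂⟩ := hcase.resolve_left hM
  obtain ⟨-, hn, hr⟩ := hB.symmetric_of_split he₁ he₂ h1 h2 hM
  have he : e1 ≠ e2 := by
    rintro rfl
    exact hne (by rw [hB.left_eq_of_split he₁, hB.symm.left_eq_of_split he₂, hn, hr])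
  rcases h1 with rfl | rfl <;> rcases h2 with rfl | rfl
  · exact absurd rfl he
  · exact SimpleGraph.exists_design_of_split hB he₁ he₂ hM
  · refine SimpleGraph.exists_design_of_split hB.symm he₂ he₁ fun hM' => hM ?_
    intro x hx y hy x' hx' y' hy'
    rw [hB.apply_comm, hM' y hy x hx y' hy' x' hx', hB.apply_comm]
  · exact absurd rfl he
end

section
/- Let v ≥ 2, b, k, r, λ be positive integers and x ≠ y integers. Let M be a v×b matrix with entries in {0,1} having all row sums equal to r and all column sums equal to k, with M·Mᵀ = (r−λ)·I + λ·J, and let X be a symmetric b×b {0,1}-matrix with zero diagonal, with X ≠ O and X ≠ J−I, such that Mᵀ·M = k·I + x·X + y·(J − I − X). Let Γ be the graph on v+b vertices whose adjacency matrix in block form is [[O, M],[Mᵀ, X]]. If Γ is connected, its adjacency matrix has exactly three distinct real eigenvalues, and Γ is not regular, then the coherent rank of Γ equals 9. -/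
open Matrix

/-- The all-ones matrix. -/
abbrev onesMatrix (m n : Type) : Matrix m n ℝ := Matrix.of fun _ _ => 1

section Ones

variable {l m n : Type} [Fintype m]

lemma onesMatrix_mul_onesMatrix :
    onesMatrix l m * onesMatrix m n = (Fintype.card m : ℝ) • onesMatrix l n := by
  ext i j
  simp [Matrix.mul_apply]

lemma mul_onesMatrix_of_row_sum {N : Matrix l m ℝ} {c : ℝ} (h : ∀ i, ∑ j, N i j = c) :
    N * onesMatrix m n = c • onesMatrix l n := by
  ext i j
  simp [Matrix.mul_apply, h]

lemma onesMatrix_mul_of_col_sum {N : Matrix m n ℝ} {c : ℝ} (h : ∀ j, ∑ i, N i j = c) :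
    onesMatrix l m * N = c • onesMatrix l n := by
  ext i j
  simp [Matrix.mul_apply, h]

/-- A bilinear closure property of matrix products can be checked on spanning sets. -/
lemma mul_mem_of_mem_span {s : Set (Matrix l m ℝ)} {t : Set (Matrix m n ℝ)}
    {U : Submodule ℝ (Matrix l n ℝ)} (h : ∀ P ∈ s, ∀ Q ∈ t, P * Q ∈ U)
    {P : Matrix l m ℝ} {Q : Matrix m n ℝ} (hP : P ∈ Submodule.span ℝ s)
    (hQ : Q ∈ Submodule.span ℝ t) : P * Q ∈ U := by
  induction hP using Submodule.span_induction with
  | zero => simp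
  | add P P' _ _ h₁ h₂ => rw [Matrix.add_mul]; exact U.add_mem h₁ h₂
  | smul c P _ h₁ => rw [Matrix.smul_mul]; exact U.smul_mem c h₁
  | mem P hP =>
    induction hQ using Submodule.span_induction with
    | zero => simp
    | add Q Q' _ _ h₁ h₂ => rw [Matrix.mul_add]; exact U.add_mem h₁ h₂
    | smul c Q _ h₁ => rw [Matrix.mul_smul]; exact U.smul_mem c h₁
    | mem Q hQ => exact h P hP Q hQ

end Ones

section Partition

variable {m n : Type} {s : ℕ} {A : Fin s → Matrix m n ℝ}

lemma apply_eq_zero_of_sum_eq_ones (h01 : ∀ i x y, A i x y = 0 ∨ A i x y = 1)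
    (hsum : ∑ i, A i = onesMatrix m n) {i j : Fin s} (hij : j ≠ i) {x : m} {y : n}
    (h : A i x y = 1) : A j x y = 0 := by
  have hxy : ∑ i, A i x y = 1 := by
    simpa [Matrix.sum_apply] using congrFun (congrFun hsum x) y
  have hle : ∑ l ∈ {i, j}, A l x y ≤ ∑ l, A l x y :=
    Finset.sum_le_sum_of_subset_of_nonneg (Finset.subset_univ _) fun l _ _ => by
      rcases h01 l x y with h | h <;> simp [h]
  rw [hxy, Finset.sum_pair hij.symm, h] at hle
  rcases h01 j x y with h' | h'
  · exact h'
  · linarith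

lemma linearIndependent_of_sum_eq_ones (h01 : ∀ i x y, A i x y = 0 ∨ A i x y = 1)
    (hsum : ∑ i, A i = onesMatrix m n) (hne : ∀ i, A i ≠ 0) : LinearIndependent ℝ A := by
  rw [Fintype.linearIndependent_iff]
  intro g hg i
  obtain ⟨x, y, hxy⟩ : ∃ x y, A i x y = 1 := by
    by_contra! hcon
    exact hne i (by ext x y; exact (h01 i x y).resolve_right (hcon x y))
  have h := congrFun (congrFun hg x) y
  rw [Matrix.sum_apply, Finset.sum_eq_single i] at h
  · simpa [hxy] using h
  · intro j _ hj
    simp [apply_eq_zero_of_sum_eq_ones h01 hsum hj hxy]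
  · simp

lemma hadamard_mem_span_of_sum_eq_ones (h01 : ∀ i x y, A i x y = 0 ∨ A i x y = 1)
    (hsum : ∑ i, A i = onesMatrix m n) {P Q : Matrix m n ℝ}
    (hP : P ∈ Submodule.span ℝ (Set.range A)) (hQ : Q ∈ Submodule.span ℝ (Set.range A)) :
    P ⊙ Q ∈ Submodule.span ℝ (Set.range A) := by
  induction hP using Submodule.span_induction with
  | zero => simp
  | add P P' _ _ h₁ h₂ => rw [Matrix.add_hadamard]; exact Submodule.add_mem _ h₁ h₂
  | smul c P _ h₁ => rw [Matrix.smul_hadamard]; exact Submodule.smul_mem _ c h₁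
  | mem P hP =>
    induction hQ using Submodule.span_induction with
    | zero => simp
    | add Q Q' _ _ h₁ h₂ => rw [Matrix.hadamard_add]; exact Submodule.add_mem _ h₁ h₂
    | smul c Q _ h₁ => rw [Matrix.hadamard_smul]; exact Submodule.smul_mem _ c h₁
    | mem Q hQ =>
      obtain ⟨i, rfl⟩ := hP
      obtain ⟨j, rfl⟩ := hQ
      by_cases hij : j = i
      · subst hij
        convert Submodule.subset_span (R := ℝ) (Set.mem_range_self (f := A) j) using 1
        rw [SetLike.mem_coe]
        congr! 1
        ext x y
        rcases h01 j x y with h | h <;> simp [h]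
      · convert Submodule.zero_mem _ using 1
        ext x y
        rcases h01 i x y with h | h
        · simp [h]
        · simp [apply_eq_zero_of_sum_eq_ones h01 hsum hij h]

end Partition

section Blocks

variable {m n : Type} [DecidableEq m] [DecidableEq n]

/-- The nine relations on points and blocks of a design with incidence matrix `M` and block
graph `X`. -/
def designRelation (M : Matrix m n ℝ) (X : Matrix n n ℝ) : Fin 9 → Matrix (m ⊕ n) (m ⊕ n) ℝ :=
  ![fromBlocks 1 0 0 0, fromBlocks (onesMatrix m m - 1) 0 0 0,
    fromBlocks 0 M 0 0, fromBlocks 0 (onesMatrix m n - M) 0 0,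
    fromBlocks 0 0 Mᵀ 0, fromBlocks 0 0 (onesMatrix n m - Mᵀ) 0,
    fromBlocks 0 0 0 1, fromBlocks 0 0 0 X, fromBlocks 0 0 0 (onesMatrix n n - 1 - X)]

lemma designRelation_eq_zero_or_one {M : Matrix m n ℝ} {X : Matrix n n ℝ}
    (hM01 : ∀ i j, M i j = 0 ∨ M i j = 1) (hXdiag : ∀ i, X i i = 0)
    (hX01 : ∀ i j, X i j = 0 ∨ X i j = 1) (i : Fin 9) (p q : m ⊕ n) :
    designRelation M X i p q = 0 ∨ designRelation M X i p q = 1 := by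
  have hM' (i j) : 1 - M i j = 0 ∨ 1 - M i j = 1 := by
    rcases hM01 i j with h | h <;> norm_num [h]
  have hone {l : Type} [DecidableEq l] (i j : l) :
      (1 : Matrix l l ℝ) i j = 0 ∨ (1 : Matrix l l ℝ) i j = 1 := by
    rw [Matrix.one_apply]
    split_ifs <;> simp
  have hone' (i j : m) : 1 - (1 : Matrix m m ℝ) i j = 0 ∨ 1 - (1 : Matrix m m ℝ) i j = 1 := by
    rcases hone i j with h | h <;> norm_num [h]
  have hX' (i j : n) : 1 - (1 : Matrix n n ℝ) i j - X i j = 0 ∨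
      1 - (1 : Matrix n n ℝ) i j - X i j = 1 := by
    by_cases h : i = j
    · subst h; simp [hXdiag]
    · rcases hX01 i j with h' | h' <;> simp [h, h']
  rcases p with p | p <;> rcases q with q | q <;> fin_cases i <;>
    simp [designRelation, hM01, hM', hX01, hone, hone', hX', -sub_eq_self]

lemma sum_designRelation (M : Matrix m n ℝ) (X : Matrix n n ℝ) :
    ∑ i, designRelation M X i = onesMatrix (m ⊕ n) (m ⊕ n) := by
  ext p q
  rcases p with p | p <;> rcases q with q | q <;>
    simp [designRelation, Fin.sum_univ_succ]

lemma transpose_designRelation (M : Matrix m n ℝ) {X : Matrix n n ℝ} (hX : Xᵀ = X)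
    (i : Fin 9) : ∃ j, (designRelation M X i)ᵀ = designRelation M X j := by
  have hJ {l l' : Type} : (onesMatrix l l')ᵀ = onesMatrix l' l := rfl
  refine ⟨![0, 1, 4, 5, 2, 3, 6, 7, 8] i, ?_⟩
  fin_cases i <;>
    simp [designRelation, fromBlocks_transpose, transpose_sub, hX, hJ]

lemma fromBlocks_mem_span_designRelation {M : Matrix m n ℝ} {X : Matrix n n ℝ}
    {P : Matrix m m ℝ} {Q : Matrix m n ℝ} {R : Matrix n m ℝ} {S : Matrix n n ℝ}
    (hP : P ∈ Submodule.span ℝ {1, onesMatrix m m})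
    (hQ : Q ∈ Submodule.span ℝ {M, onesMatrix m n})
    (hR : R ∈ Submodule.span ℝ {Mᵀ, onesMatrix n m})
    (hS : S ∈ Submodule.span ℝ {1, X, onesMatrix n n}) :
    fromBlocks P Q R S ∈ Submodule.span ℝ (Set.range (designRelation M X)) := by
  obtain ⟨p, p', rfl⟩ := Submodule.mem_span_pair.1 hP
  obtain ⟨q, q', rfl⟩ := Submodule.mem_span_pair.1 hQ
  obtain ⟨t, t', rfl⟩ := Submodule.mem_span_pair.1 hR
  obtain ⟨u, u', u'', rfl⟩ := Submodule.mem_span_triple.1 hS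
  rw [Submodule.mem_span_range_iff_exists_fun]
  refine ⟨![p + p', p', q + q', q', t + t', t', u + u'', u' + u'', u''], ?_⟩
  ext a c
  rcases a with a | a <;> rcases c with c | c <;>
    simp [designRelation, Fin.sum_univ_succ] <;> ring

lemma exists_fromBlocks_of_mem_range_designRelation {M : Matrix m n ℝ} {X : Matrix n n ℝ}
    (i : Fin 9) : ∃ P ∈ Submodule.span ℝ {1, onesMatrix m m},
      ∃ Q ∈ Submodule.span ℝ {M, onesMatrix m n},
      ∃ R ∈ Submodule.span ℝ {Mᵀ, onesMatrix n m},
      ∃ S ∈ Submodule.span ℝ {1, X, onesMatrix n n},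
      designRelation M X i = fromBlocks P Q R S := by
  have h1 : (1 : Matrix m m ℝ) ∈ Submodule.span ℝ {1, onesMatrix m m} :=
    Submodule.subset_span (by simp)
  have h1' : onesMatrix m m ∈ Submodule.span ℝ {1, onesMatrix m m} :=
    Submodule.subset_span (by simp)
  have h2 : M ∈ Submodule.span ℝ {M, onesMatrix m n} := Submodule.subset_span (by simp)
  have h2' : onesMatrix m n ∈ Submodule.span ℝ {M, onesMatrix m n} :=
    Submodule.subset_span (by simp)
  have h3 : Mᵀ ∈ Submodule.span ℝ {Mᵀ, onesMatrix n m} := Submodule.subset_span (by simp)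
  have h3' : onesMatrix n m ∈ Submodule.span ℝ {Mᵀ, onesMatrix n m} :=
    Submodule.subset_span (by simp)
  have h4 : (1 : Matrix n n ℝ) ∈ Submodule.span ℝ {1, X, onesMatrix n n} :=
    Submodule.subset_span (by simp)
  have h4' : X ∈ Submodule.span ℝ {1, X, onesMatrix n n} := Submodule.subset_span (by simp)
  have h4'' : onesMatrix n n ∈ Submodule.span ℝ {1, X, onesMatrix n n} :=
    Submodule.subset_span (by simp)
  fin_cases i
  · exact ⟨_, h1, 0, zero_mem _, 0, zero_mem _, 0, zero_mem _, rfl⟩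
  · exact ⟨_, sub_mem h1' h1, 0, zero_mem _, 0, zero_mem _, 0, zero_mem _, rfl⟩
  · exact ⟨0, zero_mem _, _, h2, 0, zero_mem _, 0, zero_mem _, rfl⟩
  · exact ⟨0, zero_mem _, _, sub_mem h2' h2, 0, zero_mem _, 0, zero_mem _, rfl⟩
  · exact ⟨0, zero_mem _, 0, zero_mem _, _, h3, 0, zero_mem _, rfl⟩
  · exact ⟨0, zero_mem _, 0, zero_mem _, _, sub_mem h3' h3, 0, zero_mem _, rfl⟩
  · exact ⟨0, zero_mem _, 0, zero_mem _, 0, zero_mem _, _, h4, rfl⟩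
  · exact ⟨0, zero_mem _, 0, zero_mem _, 0, zero_mem _, _, h4', rfl⟩
  · exact ⟨0, zero_mem _, 0, zero_mem _, 0, zero_mem _, _, sub_mem (sub_mem h4'' h4) h4', rfl⟩

variable [Fintype m] [Fintype n]

/-- The relations of a quasi-symmetric design span an algebra. -/
lemma designRelation_mul_mem {M : Matrix m n ℝ} {X : Matrix n n ℝ} {r k l d a a' c c' c'' : ℝ}
    (hrow : ∀ i, ∑ j, M i j = r) (hcol : ∀ j, ∑ i, M i j = k)
    (hX : Xᵀ = X) (hXJ : ∀ i, ∑ j, X i j = d)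
    (hMMt : M * Mᵀ = (r - l) • (1 : Matrix m m ℝ) + l • onesMatrix m m)
    (hMtM : Mᵀ * M ∈ Submodule.span ℝ {1, X, onesMatrix n n})
    (hMX : M * X = a • M + a' • onesMatrix m n)
    (hXX : X * X = c • 1 + c' • X + c'' • onesMatrix n n) (i j : Fin 9) :
    designRelation M X i * designRelation M X j ∈
      Submodule.span ℝ (Set.range (designRelation M X)) := by
  have hcomb {U : Submodule ℝ (Matrix n n ℝ)} (h₁ : 1 ∈ U) (h₂ : X ∈ U)
      (h₃ : onesMatrix n n ∈ U) : X * X ∈ U :=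
    hXX ▸ add_mem (add_mem (U.smul_mem c h₁) (U.smul_mem c' h₂)) (U.smul_mem c'' h₃)
  have hXMt : X * Mᵀ = a • Mᵀ + a' • onesMatrix n m := by
    have := congrArg transpose hMX
    rwa [transpose_mul, hX, transpose_add, transpose_smul, transpose_smul] at this
  have hXcol (j) : ∑ i, X i j = d := by
    rw [← hXJ j]
    exact Finset.sum_congr rfl fun i _ => congrFun (congrFun hX j) i
  have hXJ' {l : Type} : X * onesMatrix n l = _ := mul_onesMatrix_of_row_sum hXJ
  have hJX {l : Type} : onesMatrix l n * X = _ := onesMatrix_mul_of_col_sum hXcol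
  have hMJ {l : Type} : M * onesMatrix n l = _ := mul_onesMatrix_of_row_sum hrow
  have hJM {l : Type} : onesMatrix l m * M = _ := onesMatrix_mul_of_col_sum hcol
  have hMtJ {l : Type} : Mᵀ * onesMatrix m l = _ := mul_onesMatrix_of_row_sum hcol
  have hJMt {l : Type} : onesMatrix l n * Mᵀ = _ := onesMatrix_mul_of_col_sum hrow
  have hP1 : (1 : Matrix m m ℝ) ∈ Submodule.span ℝ {1, onesMatrix m m} :=
    Submodule.subset_span (by simp)
  have hPJ : onesMatrix m m ∈ Submodule.span ℝ {1, onesMatrix m m} :=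
    Submodule.subset_span (by simp)
  have hQM : M ∈ Submodule.span ℝ {M, onesMatrix m n} := Submodule.subset_span (by simp)
  have hQJ : onesMatrix m n ∈ Submodule.span ℝ {M, onesMatrix m n} :=
    Submodule.subset_span (by simp)
  have hRM : Mᵀ ∈ Submodule.span ℝ {Mᵀ, onesMatrix n m} := Submodule.subset_span (by simp)
  have hRJ : onesMatrix n m ∈ Submodule.span ℝ {Mᵀ, onesMatrix n m} :=
    Submodule.subset_span (by simp)
  have hS1 : (1 : Matrix n n ℝ) ∈ Submodule.span ℝ {1, X, onesMatrix n n} :=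
    Submodule.subset_span (by simp)
  have hSX : X ∈ Submodule.span ℝ {1, X, onesMatrix n n} := Submodule.subset_span (by simp)
  have hSJ : onesMatrix n n ∈ Submodule.span ℝ {1, X, onesMatrix n n} :=
    Submodule.subset_span (by simp)
  obtain ⟨P, hP, Q, hQ, R, hR, S, hS, hi⟩ :=
    exists_fromBlocks_of_mem_range_designRelation (M := M) (X := X) i
  obtain ⟨P', hP', Q', hQ', R', hR', S', hS', hj⟩ :=
    exists_fromBlocks_of_mem_range_designRelation (M := M) (X := X) j
  rw [hi, hj, fromBlocks_multiply]
  refine fromBlocks_mem_span_designRelation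
    (add_mem (mul_mem_of_mem_span ?_ hP hP') (mul_mem_of_mem_span ?_ hQ hR'))
    (add_mem (mul_mem_of_mem_span ?_ hP hQ') (mul_mem_of_mem_span ?_ hQ hS'))
    (add_mem (mul_mem_of_mem_span ?_ hR hP') (mul_mem_of_mem_span ?_ hS hR'))
    (add_mem (mul_mem_of_mem_span ?_ hR hQ') (mul_mem_of_mem_span ?_ hS hS'))
  all_goals
    simp only [Set.mem_insert_iff, Set.mem_singleton_iff, forall_eq_or_imp, forall_eq,
      Matrix.one_mul, Matrix.mul_one, onesMatrix_mul_onesMatrix, hXJ', hJX, hMJ, hJM, hMtJ, hJMt,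
      hMMt, hMX, hXMt]
    refine ⟨?_, ?_⟩
    all_goals
      simp only [hcomb hS1 hSX hSJ, hP1, hPJ, hQM, hQJ, hRM, hRJ, hS1, hSX, hSJ, hMtM, add_mem, Submodule.smul_mem,
        and_self]

end Blocks

/-- A coherent configuration containing a graph with adjacency matrix `[[O, M], [Mᵀ, X]]`, whose
degrees differ between the two parts, contains all nine design relations. -/
lemma designRelation_mem_span {m n : Type} [Fintype m] [Fintype n] [DecidableEq m]
    [DecidableEq n] {s : ℕ} {A : Fin s → Matrix (m ⊕ n) (m ⊕ n) ℝ} (hA : IsCoherentConfig A)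
    {M : Matrix m n ℝ} {X : Matrix n n ℝ} {r k d : ℝ}
    (hrow : ∀ i, ∑ j, M i j = r) (hcol : ∀ j, ∑ i, M i j = k) (hXJ : ∀ i, ∑ j, X i j = d)
    (hne : r ≠ k + d) (hmem : fromBlocks 0 M Mᵀ X ∈ Submodule.span ℝ (Set.range A)) (i : Fin 9) :
    designRelation M X i ∈ Submodule.span ℝ (Set.range A) := by
  obtain ⟨h01, hsum, -, ⟨Δ, hΔ⟩, hmul⟩ := hA
  set W := Submodule.span ℝ (Set.range A)
  have hWmul {P Q} (hP : P ∈ W) (hQ : Q ∈ W) : P * Q ∈ W := by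
    refine mul_mem_of_mem_span ?_ hP hQ
    rintro _ ⟨i, rfl⟩ _ ⟨j, rfl⟩
    exact hmul i j
  have h1 : (1 : Matrix (m ⊕ n) (m ⊕ n) ℝ) ∈ W :=
    hΔ ▸ sum_mem fun i _ => Submodule.subset_span (Set.mem_range_self i)
  have hJ : onesMatrix (m ⊕ n) (m ⊕ n) ∈ W :=
    (show ∑ i, A i = onesMatrix _ _ from hsum) ▸
      sum_mem fun i _ => Submodule.subset_span (Set.mem_range_self i)
  have hE : fromBlocks (1 : Matrix m m ℝ) 0 0 (0 : Matrix n n ℝ) ∈ W := by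
    have h := Submodule.smul_mem W (r - (k + d))⁻¹
      (sub_mem (hadamard_mem_span_of_sum_eq_ones h01 hsum (hWmul hmem hJ) h1)
        (Submodule.smul_mem W (k + d) h1))
    convert h using 1
    have hne' : r - (k + d) ≠ 0 := sub_ne_zero.2 hne
    ext p q
    by_cases hpq : p = q
    · subst hpq
      rcases p with p | p
      · simp [Matrix.mul_apply, hrow, hne']
      · simp [Matrix.mul_apply, hcol, hXJ]
    · have h0 : fromBlocks (1 : Matrix m m ℝ) 0 0 (0 : Matrix n n ℝ) p q = 0 := by
        rcases p with p | p <;> rcases q with q | q <;> simp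
        exact Matrix.one_apply_ne fun h => hpq (h ▸ rfl)
      simp [h0, hpq]
  have hF : fromBlocks (0 : Matrix m m ℝ) 0 0 (1 : Matrix n n ℝ) ∈ W := by
    convert sub_mem h1 hE using 1
    rw [← fromBlocks_one, sub_eq_add_neg, fromBlocks_neg, fromBlocks_add]
    simp
  have hJblocks : onesMatrix (m ⊕ n) (m ⊕ n) =
      fromBlocks (onesMatrix m m) (onesMatrix m n) (onesMatrix n m) (onesMatrix n n) := by
    ext p q
    rcases p with p | p <;> rcases q with q | q <;> rfl
  rw [hJblocks] at hJ
  have hM : fromBlocks 0 M 0 0 ∈ W := by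
    simpa [fromBlocks_multiply] using hWmul (hWmul hE hmem) hF
  have hMt : fromBlocks 0 0 Mᵀ 0 ∈ W := by
    simpa [fromBlocks_multiply] using hWmul (hWmul hF hmem) hE
  have hX : fromBlocks 0 0 0 X ∈ W := by
    simpa [fromBlocks_multiply] using hWmul (hWmul hF hmem) hF
  have hJ₁₁ : fromBlocks (onesMatrix m m) 0 0 0 ∈ W := by
    simpa [fromBlocks_multiply] using hWmul (hWmul hE hJ) hE
  have hJ₁₂ : fromBlocks 0 (onesMatrix m n) 0 0 ∈ W := by
    simpa [fromBlocks_multiply] using hWmul (hWmul hE hJ) hF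
  have hJ₂₁ : fromBlocks 0 0 (onesMatrix n m) 0 ∈ W := by
    simpa [fromBlocks_multiply] using hWmul (hWmul hF hJ) hE
  have hJ₂₂ : fromBlocks 0 0 0 (onesMatrix n n) ∈ W := by
    simpa [fromBlocks_multiply] using hWmul (hWmul hF hJ) hF
  fin_cases i
  · exact hE
  · simpa [sub_eq_add_neg, fromBlocks_neg, fromBlocks_add, designRelation] using sub_mem hJ₁₁ hE
  · exact hM
  · simpa [sub_eq_add_neg, fromBlocks_neg, fromBlocks_add, designRelation] using sub_mem hJ₁₂ hM
  · exact hMt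
  · simpa [sub_eq_add_neg, fromBlocks_neg, fromBlocks_add, designRelation] using sub_mem hJ₂₁ hMt
  · exact hF
  · exact hX
  · simpa [sub_eq_add_neg, fromBlocks_neg, fromBlocks_add, designRelation] using
      sub_mem (sub_mem hJ₂₂ hF) hX

/-- If `M` is the incidence matrix of a quasi-symmetric design and `X` is the adjacency
matrix of its block graph, and the graph with block adjacency matrix `[[O, M],[Mᵀ, X]]` is
connected, has exactly three distinct eigenvalues and is not regular, then it has coherent
rank `9`. -/
theorem stmt8 (v b k r lam : ℕ) (hv : 2 ≤ v) (hb : 0 < b) (hk : 0 < k) (hr : 0 < r)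
    (hlam : 0 < lam) (x y : ℤ) (hxy : x ≠ y)
    (M : Matrix (Fin v) (Fin b) ℝ)
    (hM01 : ∀ i j, M i j = 0 ∨ M i j = 1)
    (hrow : ∀ i, ∑ j, M i j = (r : ℝ))
    (hcol : ∀ j, ∑ i, M i j = (k : ℝ))
    (hMMt : M * Mᵀ = ((r : ℝ) - lam) • (1 : Matrix (Fin v) (Fin v) ℝ)
      + (lam : ℝ) • Matrix.of (fun _ _ => 1))
    (X : Matrix (Fin b) (Fin b) ℝ)
    (hXsymm : Xᵀ = X) (hXdiag : ∀ i, X i i = 0) (hX01 : ∀ i j, X i j = 0 ∨ X i j = 1)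
    (hXne0 : X ≠ 0)
    (hXneJ : X ≠ Matrix.of (fun _ _ => 1) - (1 : Matrix (Fin b) (Fin b) ℝ))
    (hMtM : Mᵀ * M = (k : ℝ) • (1 : Matrix (Fin b) (Fin b) ℝ) + (x : ℝ) • X
      + (y : ℝ) • (Matrix.of (fun _ _ => 1) - (1 : Matrix (Fin b) (Fin b) ℝ) - X))
    (G : SimpleGraph (Fin v ⊕ Fin b)) [DecidableRel G.Adj]
    (hG : SimpleGraph.adjMatrix ℝ G = Matrix.fromBlocks 0 M Mᵀ X)
    (hconn : G.Connected)
    (h3 : ∃ t0 t1 t2 : ℝ, t0 ≠ t1 ∧ t0 ≠ t2 ∧ t1 ≠ t2 ∧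
      {θ : ℝ | adjEig G θ} = {t0, t1, t2})
    (hnreg : ¬ ∃ d : ℕ, G.IsRegularOfDegree d) :
    HasCoherentRank G 9 := by
  have hxy' : (x : ℝ) - y ≠ 0 := sub_ne_zero.2 (by exact_mod_cast hxy)
  set e : ℝ := ((x : ℝ) - y)⁻¹ with he
  have hX : X = e • (Mᵀ * M - ((k : ℝ) - y) • (1 : Matrix (Fin b) (Fin b) ℝ)
      - (y : ℝ) • onesMatrix (Fin b) (Fin b)) := by
    rw [hMtM, he, eq_inv_smul_iff₀ hxy']
    module
  have hJM : onesMatrix (Fin v) (Fin v) * M = (k : ℝ) • onesMatrix (Fin v) (Fin b) :=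
    onesMatrix_mul_of_col_sum hcol
  have hJM' : onesMatrix (Fin b) (Fin v) * M = (k : ℝ) • onesMatrix (Fin b) (Fin b) :=
    onesMatrix_mul_of_col_sum hcol
  have hMJ : M * onesMatrix (Fin b) (Fin b) = (r : ℝ) • onesMatrix (Fin v) (Fin b) :=
    mul_onesMatrix_of_row_sum hrow
  have hMtJ : Mᵀ * onesMatrix (Fin v) (Fin b) = (k : ℝ) • onesMatrix (Fin b) (Fin b) :=
    mul_onesMatrix_of_row_sum hcol
  obtain ⟨d, hXd⟩ : ∃ d : ℝ, X * onesMatrix (Fin b) (Fin b) = d • onesMatrix (Fin b) (Fin b) := by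
    refine ⟨e * (r * k - ((k : ℝ) - y) - y * b), ?_⟩
    rw [hX, Matrix.smul_mul, Matrix.sub_mul, Matrix.sub_mul, Matrix.mul_assoc, hMJ,
      Matrix.mul_smul, hMtJ, Matrix.smul_mul, Matrix.smul_mul, Matrix.one_mul,
      onesMatrix_mul_onesMatrix, Fintype.card_fin]
    module
  have hXJ (i) : ∑ j, X i j = d := by
    simpa [Matrix.mul_apply] using congrFun (congrFun hXd i) i
  obtain ⟨a, a', hMX⟩ : ∃ a a' : ℝ, M * X = a • M + a' • onesMatrix (Fin v) (Fin b) := by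
    refine ⟨e * ((r - lam) - (k - y)), e * (lam * k - y * r), ?_⟩
    rw [hX, Matrix.mul_smul, Matrix.mul_sub, Matrix.mul_sub, ← Matrix.mul_assoc, hMMt,
      Matrix.add_mul, Matrix.smul_mul, Matrix.smul_mul, Matrix.one_mul, hJM, Matrix.mul_smul,
      Matrix.mul_one, Matrix.mul_smul, hMJ]
    module
  have hXMt : X * Mᵀ = a • Mᵀ + a' • onesMatrix (Fin b) (Fin v) := by
    have := congrArg transpose hMX
    rwa [transpose_mul, hXsymm, transpose_add, transpose_smul, transpose_smul] at this
  obtain ⟨c, c', c'', hXX⟩ : ∃ c c' c'' : ℝ,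
      X * X = c • 1 + c' • X + c'' • onesMatrix (Fin b) (Fin b) := by
    refine ⟨e * a * (k - y), e * (a * (x - y) - (k - y)), e * (a * y + a' * k - y * d), ?_⟩
    nth_rw 2 [hX]
    rw [Matrix.mul_smul, Matrix.mul_sub, Matrix.mul_sub, ← Matrix.mul_assoc, hXMt,
      Matrix.add_mul, Matrix.smul_mul, Matrix.smul_mul, hJM', hMtM, Matrix.mul_smul,
      Matrix.mul_one, Matrix.mul_smul, hXd]
    module
  have hMtM' : Mᵀ * M ∈ Submodule.span ℝ {1, X, onesMatrix (Fin b) (Fin b)} := by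
    refine Submodule.mem_span_triple.2 ⟨k - y, x - y, y, ?_⟩
    rw [hMtM]
    module
  have hne : (r : ℝ) ≠ k + d := by
    intro h
    refine hnreg ⟨r, fun p => ?_⟩
    have hp : (G.degree p : ℝ) = ∑ q, SimpleGraph.adjMatrix ℝ G p q := by
      simp [SimpleGraph.adjMatrix_apply, ← SimpleGraph.card_neighborFinset_eq_degree,
        SimpleGraph.neighborFinset_eq_filter]
    rw [hG] at hp
    have : (G.degree p : ℝ) = r := by
      rcases p with p | p
      · simp [hp, hrow]
      · simp [hp, hcol, hXJ, h]
    exact_mod_cast this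
  have h01 := designRelation_eq_zero_or_one hM01 hXdiag hX01
  have hXc : onesMatrix (Fin b) (Fin b) - 1 - X ≠ 0 := fun h => hXneJ (sub_eq_zero.1 h).symm
  have hMne : M ≠ onesMatrix (Fin v) (Fin b) := by
    rintro rfl
    have hentry (i j) : (v : ℝ) = k * (1 : Matrix (Fin b) (Fin b) ℝ) i j + x * X i j
        + y * (1 - (1 : Matrix (Fin b) (Fin b) ℝ) i j - X i j) := by
      simpa [Matrix.mul_apply] using congrFun (congrFun hMtM i) j
    obtain ⟨i, j, hij⟩ : ∃ i j, X i j = 1 := by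
      by_contra! hcon
      exact hXne0 (by ext i j; exact (hX01 i j).resolve_right (hcon i j))
    obtain ⟨i', j', hij'⟩ : ∃ i j, 1 - (1 : Matrix (Fin b) (Fin b) ℝ) i j - X i j ≠ 0 := by
      by_contra! hcon
      exact hXc (by ext i j; exact hcon i j)
    have hne₁ : i ≠ j := by rintro rfl; simp [hXdiag] at hij
    have hne₂ : i' ≠ j' := by rintro rfl; simp [hXdiag] at hij'
    have hX0 : X i' j' = 0 := (hX01 i' j').resolve_right fun h => by simp [h, hne₂] at hij'
    have hx := hentry i j
    have hy := hentry i' j'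
    simp only [Matrix.one_apply_ne hne₁, hij] at hx
    simp only [Matrix.one_apply_ne hne₂, hX0] at hy
    exact hxy' (by linarith)
  have hM0 : M ≠ 0 := by
    rintro rfl
    have h : (0 : ℝ) = k := by simpa using hcol ⟨0, hb⟩
    exact hk.ne (by exact_mod_cast h)
  have hJ1 : onesMatrix (Fin v) (Fin v) - 1 ≠ 0 := fun h => by
    have := congrFun (congrFun h ⟨0, by omega⟩) ⟨1, by omega⟩
    simp at this
  have : Nonempty (Fin v) := ⟨⟨0, by omega⟩⟩
  have : Nonempty (Fin b) := ⟨⟨0, hb⟩⟩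
  have hne0 (i) : designRelation M X i ≠ 0 := by
    have hMt0 : Mᵀ ≠ 0 := fun h => hM0 (by simpa using h)
    have hMtne : onesMatrix (Fin b) (Fin v) - Mᵀ ≠ 0 := fun h =>
      hMne (congrArg transpose (sub_eq_zero.1 h)).symm
    rw [← fromBlocks_zero]
    fin_cases i <;> simp only [designRelation] <;> intro h <;>
      obtain ⟨h₁, h₂, h₃, h₄⟩ := fromBlocks_inj.1 h
    · exact one_ne_zero h₁
    · exact hJ1 h₁
    · exact hM0 h₂
    · exact hMne (sub_eq_zero.1 h₂).symm
    · exact hMt0 h₃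
    · exact hMtne h₃
    · exact one_ne_zero h₄
    · exact hXne0 h₄
    · exact hXc h₄
  refine ⟨⟨designRelation M X, ⟨h01, sum_designRelation M X, transpose_designRelation M hXsymm,
    ⟨{0, 6}, ?_⟩, designRelation_mul_mem hrow hcol hXsymm hXJ hMMt hMtM' hMX hXX⟩, ?_⟩, ?_⟩
  · rw [Finset.sum_pair (by decide), ← fromBlocks_one]
    simp [designRelation, fromBlocks_add]
  · rw [hG]
    exact fromBlocks_mem_span_designRelation (zero_mem _) (Submodule.subset_span (by simp))
      (Submodule.subset_span (by simp)) (Submodule.subset_span (by simp))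
  · rintro s ⟨A, hA, hmem⟩
    rw [hG] at hmem
    have hle : Submodule.span ℝ (Set.range (designRelation M X)) ≤
        Submodule.span ℝ (Set.range A) := by
      rw [Submodule.span_le]
      rintro _ ⟨i, rfl⟩
      exact designRelation_mem_span hA hrow hcol hXJ hne hmem i
    have hfin := Submodule.finrank_mono hle
    rw [finrank_span_eq_card
      (linearIndependent_of_sum_eq_ones h01 (sum_designRelation M X) hne0)] at hfin
    simpa using hfin.trans (finrank_range_le_card A)
end
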